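/- arXiv:math/9801109 — 13 statements merged into one kernel-verified Lean document; each statement's English description precedes it below -/
import Mathlib

section
/- For every α = (α_1,…,α_n) ∈ ℕ^n and every lattice R belonging to S_α, there exists a unique upper triangular n×n matrix x over O whose diagonal entries are x_{i,i} = ϖ^{α_i} and whose strictly upper entries x_{i,j} (for i < j) are polynomials in ϖ of degree strictly less than α_i, such that R = x·O^n (the image of O^n under multiplication by x). -/
open PowerSeries

noncomputable section

variable (K : Type*) [Field K]

/-- The submodule `O·e 0 ⊕ ⋯ ⊕ O·e i` of `O^n`: vectors supported on coordinates `≤ i`. -/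
def coordsLE {n : ℕ} (i : Fin n) :
    Submodule (PowerSeries K) (Fin n → PowerSeries K) where
  carrier := {v | ∀ j, i < j → v j = 0}
  zero_mem' := fun j _ => rfl
  add_mem' := fun {a b} ha hb j hj => by simp [ha j hj, hb j hj]
  smul_mem' := fun c v hv j hj => by simp [hv j hj]

/-- The lattice `R` belongs to the stratum `S_α`. -/
def MemS {n : ℕ} (α : Fin n → ℕ)
    (R : Submodule (PowerSeries K) (Fin n → PowerSeries K)) : Prop :=
  ∀ i : Fin n,
    Submodule.map (LinearMap.proj i) (R ⊓ coordsLE K i)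
      = Submodule.span (PowerSeries K) {X ^ α i}

/-- `R ⊆ O^n` has finite codimension as a `K`-vector space. -/
def IsLattice {n : ℕ} (R : Submodule (PowerSeries K) (Fin n → PowerSeries K)) : Prop :=
  FiniteDimensional K ((Fin n → PowerSeries K) ⧸ R.restrictScalars K)

/-- The lattice `R` belongs to the orbit `X_μ`, i.e. `R = g·ϖ^μ·O^n` for some `g ∈ GL_n(O)`. -/
def MemX {n : ℕ} (μ : Fin n → ℕ)
    (R : Submodule (PowerSeries K) (Fin n → PowerSeries K)) : Prop :=
  ∃ g : GL (Fin n) (PowerSeries K),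
    LinearMap.range (Matrix.mulVecLin
      ((g : Matrix (Fin n) (Fin n) (PowerSeries K)) *
        Matrix.diagonal fun i => X ^ μ i)) = R

/-- `u` is upper triangular unipotent. -/
def UnipUpper {A : Type*} [CommRing A] {n : ℕ} (u : Matrix (Fin n) (Fin n) A) : Prop :=
  (∀ i, u i i = 1) ∧ ∀ i j : Fin n, j < i → u i j = 0

/-- The image of `ϖ` in `F = K((ϖ))`. -/
def varpi : LaurentSeries K := algebraMap (PowerSeries K) (LaurentSeries K) X

/-- The `O`-lattice `g·O^n ⊆ F^n` generated by the columns of a matrix `g` over `F`. -/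
def latticeOf {n : ℕ} (g : Matrix (Fin n) (Fin n) (LaurentSeries K)) :
    Submodule (PowerSeries K) (Fin n → LaurentSeries K) :=
  Submodule.span (PowerSeries K) (Set.range fun j i => g i j)

/-- `Σ_{i=1}^{n-1} res(u_{i,i+1} dϖ)`. -/
def resSum {n : ℕ} (u : Matrix (Fin n) (Fin n) (LaurentSeries K)) : K :=
  ∑ i : Fin n, if h : (i : ℕ) + 1 < n then (u i ⟨(i : ℕ) + 1, h⟩).coeff (-1) else 0

/-- A lattice `R ⊆ F^n` belongs to `X_μ`. -/
def MemXF {n : ℕ} (μ : Fin n → ℕ)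
    (R : Submodule (PowerSeries K) (Fin n → LaurentSeries K)) : Prop :=
  ∃ g : GL (Fin n) (PowerSeries K),
    R = latticeOf K
      (((g : Matrix (Fin n) (Fin n) (PowerSeries K)).map
          (algebraMap (PowerSeries K) (LaurentSeries K))) *
        Matrix.diagonal fun i => varpi K ^ μ i)

/-- The canonical inclusion `O^n →ₗ[O] F^n`. -/
def toLaurent (n : ℕ) : (Fin n → PowerSeries K) →ₗ[PowerSeries K] (Fin n → LaurentSeries K) :=
  LinearMap.pi fun i =>
    (Algebra.linearMap (PowerSeries K) (LaurentSeries K)).comp (LinearMap.proj i)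

section Stratum

variable {K} {n : ℕ} {α : Fin n → ℕ} {R : Submodule (PowerSeries K) (Fin n → PowerSeries K)}

theorem MemS.X_pow_dvd (hS : MemS K α R) {i : Fin n} {v : Fin n → PowerSeries K}
    (hv : v ∈ R) (hi : v ∈ coordsLE K i) : X ^ α i ∣ v i := by
  have h : v i ∈ Submodule.span (PowerSeries K) {(X : PowerSeries K) ^ α i} := by
    rw [← hS i]
    exact ⟨v, ⟨hv, hi⟩, rfl⟩
  obtain ⟨q, hq⟩ := Submodule.mem_span_singleton.1 h
  exact ⟨q, by rw [← hq, smul_eq_mul, mul_comm]⟩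

theorem MemS.exists_apply_eq (hS : MemS K α R) (i : Fin n) :
    ∃ w ∈ R, w ∈ coordsLE K i ∧ w i = X ^ α i := by
  have h := Submodule.mem_span_singleton_self (R := PowerSeries K) ((X : PowerSeries K) ^ α i)
  rw [← hS i] at h
  obtain ⟨w, ⟨hw, hwi⟩, h⟩ := h
  exact ⟨w, hw, hwi, h⟩

/-- Division with remainder: the first `k` coordinates of a vector can be reduced modulo `R`
to polynomials of degree `< α i`. -/
theorem MemS.exists_reduction (hS : MemS K α R) (k : ℕ) (v : Fin n → PowerSeries K) :
    ∃ r ∈ R, (∀ i : Fin n, k ≤ i → r i = 0) ∧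
      ∀ i : Fin n, (i : ℕ) < k →
        ∃ p : Polynomial K, p.degree < (α i : WithBot ℕ) ∧ v i - r i = (p : PowerSeries K) := by
  induction k generalizing v with
  | zero => exact ⟨0, R.zero_mem, fun _ _ => rfl, fun i hi => absurd hi (Nat.not_lt_zero _)⟩
  | succ k ih =>
    by_cases hk : k < n
    · obtain ⟨w, hw, hwk, hwα⟩ := hS.exists_apply_eq ⟨k, hk⟩
      have hdiv := eq_shift_mul_X_pow_add_trunc (α ⟨k, hk⟩) (v ⟨k, hk⟩)
      set q : PowerSeries K := PowerSeries.mk fun i => coeff (i + α ⟨k, hk⟩) (v ⟨k, hk⟩)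
      obtain ⟨r, hr, hr0, hrp⟩ := ih (v - q • w)
      refine ⟨r + q • w, R.add_mem hr (R.smul_mem q hw), fun i hi => ?_, fun i hi => ?_⟩
      · simp [hr0 i (by omega), hwk i (Fin.lt_def.2 hi)]
      · rcases Nat.lt_succ_iff_lt_or_eq.1 hi with hi | hi
        · obtain ⟨p, hp, h⟩ := hrp i hi
          refine ⟨p, hp, h ▸ ?_⟩
          simp only [Pi.add_apply, Pi.sub_apply]
          ring
        · obtain rfl : i = ⟨k, hk⟩ := Fin.ext hi
          refine ⟨trunc _ (v ⟨k, hk⟩), degree_trunc_lt _ _, ?_⟩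
          rw [Pi.add_apply, hr0 _ le_rfl, Pi.smul_apply, hwα, smul_eq_mul, zero_add,
            sub_eq_iff_eq_add']
          exact hdiv
    · obtain ⟨r, hr, hr0, hrp⟩ := ih v
      exact ⟨r, hr, fun i hi => hr0 i (by omega), fun i _ => hrp i (by omega)⟩

theorem MemS.le_of_mem (hS : MemS K α R) {P : Submodule (PowerSeries K) (Fin n → PowerSeries K)}
    {c : Fin n → Fin n → PowerSeries K} (hcR : ∀ i, c i ∈ R) (hcP : ∀ i, c i ∈ P)
    (hc : ∀ i, c i ∈ coordsLE K i) (hcα : ∀ i, c i i = X ^ α i) : R ≤ P := by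
  suffices h : ∀ (k : ℕ) (v : Fin n → PowerSeries K), v ∈ R →
      (∀ i : Fin n, k ≤ i → v i = 0) → v ∈ P from
    fun v hv => h n v hv fun i hi => absurd i.isLt (not_lt.2 hi)
  intro k
  induction k with
  | zero =>
    intro v _ hv
    rw [show v = 0 from funext fun i => hv i (Nat.zero_le _)]
    exact P.zero_mem
  | succ k ih =>
    intro v hv hv0
    by_cases hk : k < n
    · obtain ⟨q, hq⟩ := hS.X_pow_dvd (i := ⟨k, hk⟩) hv fun i hi => hv0 i (Fin.lt_def.1 hi)
      rw [← sub_add_cancel v (q • c ⟨k, hk⟩)]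
      refine P.add_mem (ih _ (R.sub_mem hv (R.smul_mem q (hcR _))) fun i hi => ?_)
        (P.smul_mem q (hcP _))
      rcases hi.eq_or_lt with hi | hi
      · obtain rfl : i = ⟨k, hk⟩ := Fin.ext hi.symm
        rw [Pi.sub_apply, Pi.smul_apply, hcα, hq, smul_eq_mul, mul_comm, sub_self]
      · simp [hv0 i hi, hc ⟨k, hk⟩ i (Fin.lt_def.2 hi)]
    · exact ih v hv fun i hi => absurd i.isLt (by omega)

theorem MemS.eq_zero_of_coeff_eq_zero (hS : MemS K α R) {v : Fin n → PowerSeries K} (hv : v ∈ R)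
    (h : ∀ i m, α i ≤ m → coeff m (v i) = 0) : v = 0 := by
  funext i
  induction i using WellFoundedGT.induction with
  | ind i ih =>
    ext m
    rcases lt_or_ge m (α i) with hm | hm
    · exact X_pow_dvd_iff.1 (hS.X_pow_dvd hv fun j hj => ih j hj) m hm
    · exact h i m hm

theorem coeff_eq_zero_of_eq_coe {f : PowerSeries K} {a : ℕ}
    (h : ∃ p : Polynomial K, p.degree < (a : WithBot ℕ) ∧ f = (p : PowerSeries K))
    {m : ℕ} (hm : a ≤ m) : coeff m f = 0 := by
  obtain ⟨p, hp, rfl⟩ := h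
  rw [Polynomial.coeff_coe]
  exact Polynomial.coeff_eq_zero_of_degree_lt (hp.trans_le (WithBot.coe_le_coe.2 hm))

theorem col_mem_range_mulVecLin (x : Matrix (Fin n) (Fin n) (PowerSeries K)) (j : Fin n) :
    x.col j ∈ LinearMap.range x.mulVecLin :=
  ⟨Pi.single j 1, by rw [Matrix.mulVecLin_apply, Matrix.mulVec_single_one]⟩

end Stratum

/-- For every `α ∈ ℕ^n` and every lattice `R ∈ S_α`, there is a unique upper
triangular matrix `x` over `O` with diagonal entries `ϖ^{α_i}` and strictly upper entries
polynomials in `ϖ` of degree `< α_i`, such that `R = x·O^n`. -/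
theorem stmt0 {n : ℕ} (α : Fin n → ℕ)
    (R : Submodule (PowerSeries K) (Fin n → PowerSeries K))
    (hR : IsLattice K R) (hS : MemS K α R) :
    ∃! x : Matrix (Fin n) (Fin n) (PowerSeries K),
      (∀ i, x i i = X ^ α i) ∧
      (∀ i j : Fin n, j < i → x i j = 0) ∧
      (∀ i j : Fin n, i < j →
        ∃ p : Polynomial K, p.degree < (α i : WithBot ℕ) ∧ x i j = (p : PowerSeries K)) ∧
      LinearMap.range x.mulVecLin = R := by
  choose w hwR hw hwα using hS.exists_apply_eq
  choose r hrR hr0 hrp using fun j : Fin n => hS.exists_reduction j (w j)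
  have hcR : ∀ j, w j - r j ∈ R := fun j => R.sub_mem (hwR j) (hrR j)
  have hcα : ∀ j, (w j - r j) j = X ^ α j := fun j => by
    rw [Pi.sub_apply, hwα, hr0 j j le_rfl, sub_zero]
  have hc : ∀ j, w j - r j ∈ coordsLE K j := fun j i hji => by
    rw [Pi.sub_apply, hw j i hji, hr0 j i hji.le, sub_zero]
  refine ⟨Matrix.of fun i j => (w j - r j) i,
    ⟨hcα, fun i j hji => hc j i hji, fun i j hij => hrp j i hij, le_antisymm ?_ ?_⟩, ?_⟩
  · rw [Matrix.range_mulVecLin, Submodule.span_le]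
    rintro _ ⟨j, rfl⟩
    exact hcR j
  · exact hS.le_of_mem hcR (fun j => col_mem_range_mulVecLin (.of fun i j => (w j - r j) i) j)
      hc hcα
  · rintro y ⟨hyα, hy0, hyp, hyR⟩
    ext1 i j
    have hyj : y.col j ∈ R := hyR ▸ col_mem_range_mulVecLin y j
    have h := hS.eq_zero_of_coeff_eq_zero (R.sub_mem hyj (hcR j)) fun i m hm => by
      rw [Pi.sub_apply, map_sub, Matrix.col_apply]
      rcases lt_trichotomy i j with hij | rfl | hji
      · rw [coeff_eq_zero_of_eq_coe (hyp i j hij) hm, Pi.sub_apply,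
          coeff_eq_zero_of_eq_coe (hrp j i hij) hm, sub_zero]
      · rw [hyα, hcα, sub_self]
      · rw [hy0 i j hji, hc j i hji, sub_self]
    exact sub_eq_zero.1 (congrFun h i)

end
end

section
/- Let α = (α_1,…,α_n) ∈ ℕ^n and let V_α ⊆ O^n be the K-subspace consisting of vectors whose j-th entry is a polynomial in ϖ of degree strictly less than α_j for every j. Then for every lattice R belonging to S_α, one has O^n = R ⊕ V_α as K-vector spaces. -/
open PowerSeries

noncomputable section

variable (K : Type*) [Field K]

/-- The `K`-subspace of `O` consisting of polynomials in `ϖ` of degree `< a`. -/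
def degLT (a : ℕ) : Submodule K (PowerSeries K) where
  carrier := {f | ∃ p : Polynomial K, p.degree < (a : WithBot ℕ) ∧ f = (p : PowerSeries K)}
  zero_mem' := ⟨0, by simp only [Polynomial.degree_zero]; exact WithBot.bot_lt_coe a, by simp⟩
  add_mem' := by
    rintro f g ⟨p, hp, rfl⟩ ⟨q, hq, rfl⟩
    exact ⟨p + q, lt_of_le_of_lt (Polynomial.degree_add_le p q) (max_lt hp hq),
      by push_cast; ring⟩
  smul_mem' := by
    rintro c f ⟨p, hp, rfl⟩
    refine ⟨c • p, lt_of_le_of_lt (Polynomial.degree_smul_le c p) hp, ?_⟩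
    rw [Polynomial.smul_eq_C_mul]
    push_cast
    rw [smul_eq_C_mul]

variable {K} in
theorem trunc_mem_degLT (a : ℕ) (f : PowerSeries K) :
    (trunc a f : PowerSeries K) ∈ degLT K a :=
  ⟨trunc a f, degree_trunc_lt f a, rfl⟩

variable {K} in
theorem X_pow_dvd_sub_trunc (a : ℕ) (f : PowerSeries K) :
    (X : PowerSeries K) ^ a ∣ f - (trunc a f : PowerSeries K) := by
  rw [X_pow_dvd_iff]
  intro m hm
  rw [map_sub, coeff_coe_trunc_of_lt hm, sub_self]

variable {K} in
theorem eq_zero_of_mem_degLT_of_X_pow_dvd {a : ℕ} {f : PowerSeries K} (hf : f ∈ degLT K a)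
    (hdvd : (X : PowerSeries K) ^ a ∣ f) : f = 0 := by
  obtain ⟨p, hp, rfl⟩ := hf
  rw [X_pow_dvd_iff] at hdvd
  ext m
  rw [map_zero]
  rcases lt_or_ge m a with hm | hm
  · exact hdvd m hm
  · rw [Polynomial.coeff_coe]
    exact Polynomial.coeff_eq_zero_of_degree_lt (hp.trans_le (by exact_mod_cast hm))

variable {K} in
theorem MemS.X_pow_dvd_of_mem {n : ℕ} {α : Fin n → ℕ}
    {R : Submodule (PowerSeries K) (Fin n → PowerSeries K)} (hS : MemS K α R) {i : Fin n}
    {v : Fin n → PowerSeries K} (hv : v ∈ R) (hvi : ∀ j, i < j → v j = 0) :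
    (X : PowerSeries K) ^ α i ∣ v i := by
  rw [← Ideal.mem_span_singleton]
  have h : v i ∈ Submodule.map (LinearMap.proj i) (R ⊓ coordsLE K i) := ⟨v, ⟨hv, hvi⟩, rfl⟩
  rwa [hS i] at h

variable {K} in
theorem MemS.exists_mem_of_X_pow_dvd {n : ℕ} {α : Fin n → ℕ}
    {R : Submodule (PowerSeries K) (Fin n → PowerSeries K)} (hS : MemS K α R) {i : Fin n}
    {f : PowerSeries K} (hf : (X : PowerSeries K) ^ α i ∣ f) :
    ∃ r ∈ R, (∀ j, i < j → r j = 0) ∧ r i = f := by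
  have h : f ∈ Submodule.span (PowerSeries K) {(X : PowerSeries K) ^ α i} :=
    Ideal.mem_span_singleton.2 hf
  rw [← hS i] at h
  obtain ⟨r, ⟨hr, hri⟩, hrf⟩ := h
  exact ⟨r, hr, hri, hrf⟩

variable {K} in
theorem MemS.eq_zero_of_mem {n : ℕ} {α : Fin n → ℕ}
    {R : Submodule (PowerSeries K) (Fin n → PowerSeries K)} (hS : MemS K α R)
    {v : Fin n → PowerSeries K} (hv : v ∈ R) (hdeg : ∀ i, v i ∈ degLT K (α i)) : v = 0 := by
  funext i
  induction i using WellFoundedGT.induction with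
  | ind i ih => exact eq_zero_of_mem_degLT_of_X_pow_dvd (hdeg i) (hS.X_pow_dvd_of_mem hv ih)

variable {K} in
theorem MemS.mem_sup_of_support_lt {n : ℕ} {α : Fin n → ℕ}
    {R : Submodule (PowerSeries K) (Fin n → PowerSeries K)} (hS : MemS K α R) (k : ℕ)
    (hk : k ≤ n) (v : Fin n → PowerSeries K) (hv : ∀ j : Fin n, k ≤ j → v j = 0) :
    v ∈ R.restrictScalars K ⊔ Submodule.pi Set.univ fun j => degLT K (α j) := by
  induction k generalizing v with
  | zero =>
    obtain rfl : v = 0 := funext fun j => hv j (Nat.zero_le _)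
    exact zero_mem _
  | succ k ih =>
    set i : Fin n := ⟨k, hk⟩
    obtain ⟨r, hr, hrlt, hri⟩ := hS.exists_mem_of_X_pow_dvd (X_pow_dvd_sub_trunc (α i) (v i))
    set w : Fin n → PowerSeries K := Pi.single i (trunc (α i) (v i) : PowerSeries K) with hw
    have hwmem : w ∈ Submodule.pi Set.univ fun j => degLT K (α j) := by
      intro j _
      by_cases hj : j = i
      · subst hj
        simpa [hw] using trunc_mem_degLT _ _
      · simp [hw, hj]
    have hrest := ih (Nat.le_of_succ_le hk) (v - (r + w)) fun j hj => by
      rcases eq_or_ne j i with rfl | hji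
      · simp [hw, hri]
      · have hij : i < j := lt_of_le_of_ne hj hji.symm
        simp [hw, hji, hrlt j hij, hv j hij]
    rw [← sub_add_cancel v (r + w)]
    exact add_mem hrest (Submodule.add_mem_sup hr hwmem)

/-- For `R ∈ S_α` a lattice, `O^n = R ⊕ V_α` as `K`-vector spaces, where `V_α`
is the space of vectors whose `j`-th entry is a polynomial in `ϖ` of degree `< α_j`. -/
theorem stmt1 {n : ℕ} (α : Fin n → ℕ)
    (R : Submodule (PowerSeries K) (Fin n → PowerSeries K))
    (hR : IsLattice K R) (hS : MemS K α R) :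
    IsCompl (R.restrictScalars K) (Submodule.pi Set.univ fun j => degLT K (α j)) := by
  refine ⟨Submodule.disjoint_def.2 fun v hv hdeg => ?_, codisjoint_iff_le_sup.2 fun v _ => ?_⟩
  · exact hS.eq_zero_of_mem hv fun i => hdeg i trivial
  · exact hS.mem_sup_of_support_lt n le_rfl v fun j hj => absurd j.isLt hj.not_gt

end
end

section
/- Let α = (α_1,…,α_n) ∈ ℕ^n and let R be a lattice belonging to S_α in O^n. Set R' = R ∩ (Oe_1 ⊕ ⋯ ⊕ Oe_{n-1}). Then R', viewed inside O^{n-1}, belongs to S_{(α_1,…,α_{n-1})}, and there exists y ∈ Oe_1 ⊕ ⋯ ⊕ Oe_{n-1}, unique modulo R', such that R = R' ⊕ (ϖ^{α_n}e_n + y)O. -/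
open PowerSeries

noncomputable section

variable (K : Type*) [Field K]

/-- For `R ∈ S_α` in `O^{n+1}`, the lattice `R' = R ∩ (Oe_1 ⊕ ⋯ ⊕ Oe_n)`,
viewed inside `O^n`, belongs to `S_{(α_1,…,α_n)}`, and there is a `y ∈ Oe_1 ⊕ ⋯ ⊕ Oe_n`,
unique modulo `R'`, such that `R = R' ⊕ (ϖ^{α_{n+1}}e_{n+1} + y)·O`. -/
theorem stmt2 {n : ℕ} (α : Fin (n + 1) → ℕ)
    (R : Submodule (PowerSeries K) (Fin (n + 1) → PowerSeries K))
    (hR : IsLattice K R) (hS : MemS K α R) :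
    MemS K (fun j : Fin n => α j.castSucc)
      (Submodule.map
        (LinearMap.funLeft (PowerSeries K) (PowerSeries K) Fin.castSucc)
        (R ⊓ LinearMap.ker (LinearMap.proj (Fin.last n)))) ∧
    ∃ y ∈ LinearMap.ker
        (LinearMap.proj (R := PowerSeries K) (φ := fun _ : Fin (n + 1) => PowerSeries K)
          (Fin.last n)),
      ((R ⊓ LinearMap.ker (LinearMap.proj (Fin.last n))) ⊔
          Submodule.span (PowerSeries K)
            {Pi.single (Fin.last n) (X ^ α (Fin.last n)) + y} = R ∧
        Disjoint (R ⊓ LinearMap.ker (LinearMap.proj (Fin.last n)))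
          (Submodule.span (PowerSeries K)
            {Pi.single (Fin.last n) (X ^ α (Fin.last n)) + y})) ∧
      ∀ y' ∈ LinearMap.ker
          (LinearMap.proj (R := PowerSeries K) (φ := fun _ : Fin (n + 1) => PowerSeries K)
            (Fin.last n)),
        ((R ⊓ LinearMap.ker (LinearMap.proj (Fin.last n))) ⊔
            Submodule.span (PowerSeries K)
              {Pi.single (Fin.last n) (X ^ α (Fin.last n)) + y'} = R ∧
          Disjoint (R ⊓ LinearMap.ker (LinearMap.proj (Fin.last n)))
            (Submodule.span (PowerSeries K)
              {Pi.single (Fin.last n) (X ^ α (Fin.last n)) + y'})) →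
        y' - y ∈ R ⊓ LinearMap.ker (LinearMap.proj (Fin.last n)) := by
  have memker : ∀ v : Fin (n + 1) → PowerSeries K, v ∈ LinearMap.ker
      (LinearMap.proj (R := PowerSeries K) (φ := fun _ : Fin (n + 1) => PowerSeries K)
        (Fin.last n)) ↔ v (Fin.last n) = 0 := fun v => Iff.rfl
  constructor
  · intro i
    rw [← hS i.castSucc]
    ext p
    simp only [Submodule.mem_map, Submodule.mem_inf, memker, LinearMap.proj_apply]
    constructor
    · rintro ⟨_, ⟨⟨v, ⟨hv, hv0⟩, rfl⟩, hle⟩, rfl⟩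
      refine ⟨v, ⟨hv, fun j hj => ?_⟩, rfl⟩
      induction j using Fin.lastCases with
      | last => exact hv0
      | cast j => exact hle j (Fin.castSucc_lt_castSucc_iff.mp hj)
    · rintro ⟨v, ⟨hv, hle⟩, rfl⟩
      exact ⟨_, ⟨⟨v, ⟨hv, hle _ (Fin.castSucc_lt_last i)⟩, rfl⟩,
        fun j hj => hle _ (Fin.castSucc_lt_castSucc_iff.mpr hj)⟩, rfl⟩
  · have hX : (X : PowerSeries K) ^ α (Fin.last n) ≠ 0 := pow_ne_zero _ X_ne_zero
    have hlast : ∀ v ∈ R, ∃ c : PowerSeries K, c * X ^ α (Fin.last n) = v (Fin.last n) := by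
      intro v hv
      have h : v (Fin.last n) ∈ Submodule.span (PowerSeries K) {X ^ α (Fin.last n)} := by
        rw [← hS]
        exact ⟨v, ⟨hv, fun j hj => absurd hj (Fin.le_last j).not_gt⟩, rfl⟩
      exact Submodule.mem_span_singleton.mp h
    obtain ⟨w, ⟨hw, -⟩, hwX⟩ : X ^ α (Fin.last n) ∈
        Submodule.map (LinearMap.proj (Fin.last n)) (R ⊓ coordsLE K (Fin.last n)) := by
      rw [hS]
      exact Submodule.mem_span_singleton_self _
    replace hwX : w (Fin.last n) = X ^ α (Fin.last n) := hwX
    refine ⟨w - Pi.single (Fin.last n) (X ^ α (Fin.last n)), ?_, ⟨?_, ?_⟩, ?_⟩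
    · simp [memker, hwX]
    · rw [add_sub_cancel]
      refine le_antisymm (sup_le inf_le_left ?_) fun v hv => ?_
      · rwa [Submodule.span_singleton_le_iff_mem]
      · obtain ⟨c, hc⟩ := hlast v hv
        rw [Submodule.mem_sup]
        refine ⟨v - c • w, ⟨R.sub_mem hv (R.smul_mem c hw), ?_⟩, c • w,
          Submodule.smul_mem _ _ (Submodule.mem_span_singleton_self w), sub_add_cancel _ _⟩
        simp [hwX, hc]
    · rw [add_sub_cancel, Submodule.disjoint_def]
      rintro v ⟨-, hv⟩ hvw
      obtain ⟨c, rfl⟩ := Submodule.mem_span_singleton.mp hvw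
      have hc : c * w (Fin.last n) = 0 := hv
      rw [hwX] at hc
      rw [(mul_eq_zero.mp hc).resolve_right hX, zero_smul]
    · rintro y' hy' ⟨hsup, -⟩
      have hyR : Pi.single (Fin.last n) (X ^ α (Fin.last n)) + y' ∈ R := by
        rw [← hsup]
        exact Submodule.mem_sup_right (Submodule.mem_span_singleton_self _)
      refine ⟨?_, ?_⟩
      · rw [SetLike.mem_coe, sub_sub_eq_add_sub, add_comm y']
        exact R.sub_mem hyR hw
      · have h0 : y' (Fin.last n) = 0 := hy'
        simp [hwX, h0]

end
end

section
/- For every α = (α_1,…,α_n) ∈ ℕ^n, the set of lattices belonging to S_α is in bijection with the affine space K^N, where N = Σ_{i=1}^n α_i(n−i). -/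
open PowerSeries

noncomputable section

variable (K : Type*) [Field K]

variable {K}

lemma memS_iff {n : ℕ} {α : Fin n → ℕ}
    {R : Submodule (PowerSeries K) (Fin n → PowerSeries K)} :
    MemS K α R ↔ ∀ i : Fin n, (∀ v ∈ R, v ∈ coordsLE K i → X ^ α i ∣ v i) ∧
      ∃ h ∈ R, h ∈ coordsLE K i ∧ h i = X ^ α i := by
  refine forall_congr' fun i => ⟨fun H => ⟨fun v hv hvi => ?_, ?_⟩, fun ⟨H₁, H₂⟩ => ?_⟩
  · rw [← Ideal.mem_span_singleton, ← Ideal.submodule_span_eq, ← H]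
    exact ⟨v, ⟨hv, hvi⟩, rfl⟩
  · have : (X ^ α i : PowerSeries K) ∈ Submodule.span (PowerSeries K) {X ^ α i} :=
      Submodule.mem_span_singleton_self _
    rw [← H] at this
    obtain ⟨h, ⟨hR, hi⟩, e⟩ := this
    exact ⟨h, hR, hi, e⟩
  · apply le_antisymm
    · rintro _ ⟨v, ⟨hv, hvi⟩, rfl⟩
      exact Ideal.mem_span_singleton.2 (H₁ v hv hvi)
    · obtain ⟨h, hR, hi, e⟩ := H₂
      rw [Submodule.span_singleton_le_iff_mem]
      exact ⟨h, ⟨hR, hi⟩, e⟩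

/-- The power series `f` is a polynomial of degree less than `a`. -/
def IsTruncated (a : ℕ) (f : PowerSeries K) : Prop := ∀ m, a ≤ m → coeff m f = 0

lemma IsTruncated.zero (a : ℕ) : IsTruncated a (0 : PowerSeries K) := fun m _ => by simp

lemma IsTruncated.sub {a : ℕ} {f g : PowerSeries K} (hf : IsTruncated a f) (hg : IsTruncated a g) :
    IsTruncated a (f - g) := fun m hm => by simp [hf m hm, hg m hm]

lemma IsTruncated.eq_zero_of_dvd {a : ℕ} {f : PowerSeries K} (hf : IsTruncated a f)
    (h : X ^ a ∣ f) : f = 0 := by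
  ext m
  rcases lt_or_ge m a with hm | hm
  · simpa using X_pow_dvd_iff.1 h m hm
  · simpa using hf m hm

variable (K) in
/-- The polynomial of degree less than `a` with given coefficients, as a power series. -/
def ofCoeffs (a : ℕ) : (Fin a → K) →ₗ[K] PowerSeries K where
  toFun c := PowerSeries.mk fun m => if h : m < a then c ⟨m, h⟩ else 0
  map_add' c d := by ext m; by_cases h : m < a <;> simp [h]
  map_smul' r c := by ext m; by_cases h : m < a <;> simp [h]

lemma coeff_ofCoeffs {a : ℕ} (c : Fin a → K) (m : Fin a) :
    coeff m (ofCoeffs K a c) = c m := by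
  simp [ofCoeffs]

lemma isTruncated_ofCoeffs {a : ℕ} (c : Fin a → K) : IsTruncated a (ofCoeffs K a c) :=
  fun m hm => by simp [ofCoeffs, hm.not_gt]

lemma IsTruncated.ofCoeffs_eq {a : ℕ} {f : PowerSeries K} (hf : IsTruncated a f) :
    ofCoeffs K a (fun m => coeff m f) = f := by
  ext m
  by_cases h : m < a
  · simp [ofCoeffs, h]
  · simp [ofCoeffs, h, hf m (not_lt.1 h)]

lemma exists_mul_add_isTruncated (a : ℕ) (f : PowerSeries K) :
    ∃ q r : PowerSeries K, f = q * X ^ a + r ∧ IsTruncated a r := by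
  have hr := isTruncated_ofCoeffs (a := a) fun m => coeff m f
  obtain ⟨q, hq⟩ : X ^ a ∣ f - ofCoeffs K a fun m => coeff m f := by
    rw [X_pow_dvd_iff]
    intro m hm
    rw [map_sub, coeff_ofCoeffs _ ⟨m, hm⟩, sub_self]
  exact ⟨q, _, by rw [mul_comm, ← hq, sub_add_cancel], hr⟩

section Lattice

variable {n : ℕ} {α : Fin n → ℕ} {R : Submodule (PowerSeries K) (Fin n → PowerSeries K)}

lemma MemS.eq_zero_of_isTruncated (hR : MemS K α R) {d : Fin n → PowerSeries K} (hd : d ∈ R)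
    (hred : ∀ i, IsTruncated (α i) (d i)) : d = 0 := by
  by_contra hne
  obtain ⟨i, hi, hmax⟩ : ∃ i, d i ≠ 0 ∧ ∀ j, i < j → d j = 0 := by
    obtain ⟨i₀, h₀⟩ := Function.ne_iff.1 hne
    obtain ⟨i, hi⟩ := (Set.toFinite {i | d i ≠ 0}).exists_maximal ⟨i₀, h₀⟩
    exact ⟨i, hi.prop, fun j hj => by_contra fun h => (hi.not_gt h) hj⟩
  exact hi ((hred i).eq_zero_of_dvd ((memS_iff.1 hR i).1 d hd hmax))

lemma MemS.exists_isTruncated_sub (hR : MemS K α R) (k : ℕ) (v : Fin n → PowerSeries K)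
    (hv : ∀ j : Fin n, k ≤ j → v j = 0) :
    ∃ r ∈ R, (∀ j : Fin n, k ≤ j → r j = 0) ∧ ∀ i, IsTruncated (α i) (v i - r i) := by
  induction k generalizing v with
  | zero => exact ⟨0, R.zero_mem, fun _ _ => rfl, fun i => by simp [hv i, IsTruncated.zero]⟩
  | succ k ih =>
    by_cases hk : k < n
    swap
    · obtain ⟨r, hr, -, h⟩ := ih v fun j hj => by omega
      exact ⟨r, hr, fun j hj => by omega, h⟩
    obtain ⟨h, hhR, hh, hhk⟩ := (memS_iff.1 hR ⟨k, hk⟩).2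
    obtain ⟨q, s, hqs, hs⟩ := exists_mul_add_isTruncated (α ⟨k, hk⟩) (v ⟨k, hk⟩)
    obtain ⟨r, hr, hr0, hred⟩ := ih (v - q • h - Pi.single ⟨k, hk⟩ s) fun j hj => by
      rcases hj.eq_or_lt with rfl | hj
      · simp [hhk, hqs]
      · have hj' : (⟨k, hk⟩ : Fin n) < j := hj
        simp [hv j hj, hh j hj', hj'.ne']
    refine ⟨q • h + r, R.add_mem (R.smul_mem q hhR) hr, fun j hj => ?_, fun i => ?_⟩
    · simp [hh j (show (⟨k, hk⟩ : Fin n) < j from hj), hr0 j (by omega)]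
    · by_cases hik : i = ⟨k, hk⟩
      · subst hik
        simpa [hr0, hhk, hqs] using hs
      · simpa [hik, sub_sub] using hred i

lemma MemS.isLattice (hR : MemS K α R) : IsLattice K R := by
  let f : (∀ i, Fin (α i) → K) →ₗ[K] (Fin n → PowerSeries K) :=
    LinearMap.pi fun i => (ofCoeffs K (α i)).comp (LinearMap.proj i)
  refine FiniteDimensional.of_surjective ((R.restrictScalars K).mkQ ∘ₗ f) fun x => ?_
  obtain ⟨v, rfl⟩ := (R.restrictScalars K).mkQ_surjective x
  obtain ⟨r, hr, -, hred⟩ := hR.exists_isTruncated_sub n v fun j hj => by omega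
  refine ⟨fun i m => coeff m (v i - r i), ?_⟩
  have : f (fun i m => coeff m (v i - r i)) = v - r := funext fun i => (hred i).ofCoeffs_eq
  rw [LinearMap.comp_apply, this, map_sub, sub_eq_self]
  simpa using hr

lemma MemS.exists_generator (hR : MemS K α R) (j : Fin n) :
    ∃ h ∈ R, h j = X ^ α j ∧ (∀ i, j < i → h i = 0) ∧ ∀ i, i < j → IsTruncated (α i) (h i) := by
  obtain ⟨h, hhR, hh, hj⟩ := (memS_iff.1 hR j).2
  obtain ⟨r, hr, hr0, hred⟩ := hR.exists_isTruncated_sub j (h - Pi.single j (X ^ α j))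
    fun i hi => by
      rcases (show j ≤ i from hi).eq_or_lt with rfl | hi
      · simp [hj]
      · simp [hh i hi, hi.ne']
  refine ⟨h - r, R.sub_mem hhR hr, by simp [hj, hr0], fun i hi => ?_, fun i hi => ?_⟩
  · simp [hh i hi, hr0 i hi.le]
  · simpa [hi.ne] using hred i

lemma MemS.eq_span (hR : MemS K α R) {g : Fin n → Fin n → PowerSeries K}
    (hgR : ∀ j, g j ∈ R) (hg : ∀ j, g j j = X ^ α j) (hg0 : ∀ j i, j < i → g j i = 0) :
    R = Submodule.span (PowerSeries K) (Set.range g) := by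
  apply le_antisymm
  swap
  · rw [Submodule.span_le]
    rintro _ ⟨j, rfl⟩
    exact hgR j
  suffices H : ∀ k : ℕ, ∀ v ∈ R, (∀ j : Fin n, k ≤ j → v j = 0) →
      v ∈ Submodule.span (PowerSeries K) (Set.range g) from
    fun v hv => H n v hv fun j hj => by omega
  intro k
  induction k with
  | zero =>
    intro v _ hv
    rw [show v = 0 from funext fun j => hv j (Nat.zero_le _)]
    exact Submodule.zero_mem _
  | succ k ih =>
    intro v hvR hv
    by_cases hk : k < n
    swap
    · exact ih v hvR fun j hj => by omega
    obtain ⟨q, hq⟩ := (memS_iff.1 hR ⟨k, hk⟩).1 v hvR fun j hj => hv j hj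
    have := ih (v - q • g ⟨k, hk⟩) (R.sub_mem hvR (R.smul_mem q (hgR _))) fun j hj => by
      rcases hj.eq_or_lt with rfl | hj
      · simp [hg, hq, mul_comm]
      · simp [hv j hj, hg0 ⟨k, hk⟩ j hj]
    rw [← sub_add_cancel v (q • g ⟨k, hk⟩)]
    exact Submodule.add_mem _ this
      (Submodule.smul_mem _ _ (Submodule.subset_span (Set.mem_range_self _)))

lemma memS_span {g : Fin n → Fin n → PowerSeries K}
    (hg : ∀ j, g j j = X ^ α j) (hg0 : ∀ j i, j < i → g j i = 0) :
    MemS K α (Submodule.span (PowerSeries K) (Set.range g)) := by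
  refine memS_iff.2 fun i => ⟨fun v hv hvi => ?_,
    g i, Submodule.subset_span (Set.mem_range_self i), hg0 i, hg i⟩
  obtain ⟨a, rfl⟩ := (Submodule.mem_span_range_iff_exists_fun _).1 hv
  have key : ∀ j, (∀ k, j < k → a k = 0) → (∑ k, a k • g k) j = a j * X ^ α j := by
    intro j hj
    rw [Finset.sum_apply, Finset.sum_eq_single j]
    · simp [hg]
    · intro k _ hk
      rcases hk.lt_or_gt with hk | hk
      · simp [hg0 k j hk]
      · simp [hj k hk]
    · simp
  have ha : ∀ j, i < j → a j = 0 := by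
    intro j
    induction j using WellFoundedGT.induction with
    | ind j ih =>
      intro hij
      have h := key j fun k hk => ih k hk (hij.trans hk)
      rw [hvi j hij] at h
      exact (mul_eq_zero.1 h.symm).resolve_right (pow_ne_zero _ X_ne_zero)
  exact ⟨a i, by rw [key i ha, mul_comm]⟩

end Lattice

/-- Indices `(i, m, j)` with `m < α i` and `i < j`: the free coefficients of the Hermite normal
form of a lattice in `S_α`. -/
abbrev HermiteIndex {n : ℕ} (α : Fin n → ℕ) : Type :=
  Σ i : Fin n, Fin (α i) × Finset.Ioi i

/-- The `j`-th generator in the Hermite normal form with coefficients `c`. -/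
def hermiteColumn {n : ℕ} {α : Fin n → ℕ} (c : HermiteIndex α → K) (j i : Fin n) :
    PowerSeries K :=
  if h : i < j then ofCoeffs K (α i) fun m => c ⟨i, m, j, Finset.mem_Ioi.2 h⟩
  else if i = j then X ^ α i else 0

section Hermite

variable {n : ℕ} {α : Fin n → ℕ} (c : HermiteIndex α → K)

lemma hermiteColumn_self (j : Fin n) : hermiteColumn c j j = X ^ α j := by
  simp [hermiteColumn]

lemma hermiteColumn_of_lt {j i : Fin n} (h : i < j) :
    hermiteColumn c j i = ofCoeffs K (α i) fun m => c ⟨i, m, j, Finset.mem_Ioi.2 h⟩ :=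
  dif_pos h

lemma hermiteColumn_of_gt (j i : Fin n) (h : j < i) : hermiteColumn c j i = 0 := by
  simp [hermiteColumn, h.not_gt, h.ne']

/-- The lattice in `S_α` with Hermite normal form given by `c`. -/
def hermiteLattice : {R : Submodule (PowerSeries K) (Fin n → PowerSeries K) //
    IsLattice K R ∧ MemS K α R} :=
  have h := memS_span (hermiteColumn_self c) (hermiteColumn_of_gt c)
  ⟨Submodule.span (PowerSeries K) (Set.range (hermiteColumn c)), h.isLattice, h⟩

variable (K α) in
lemma hermiteLattice_bijective :
    Function.Bijective (hermiteLattice : (HermiteIndex α → K) → _) := by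
  constructor
  · intro c d hcd
    have hmem (e : HermiteIndex α → K) (j : Fin n) : hermiteColumn e j ∈ (hermiteLattice e).1 :=
      Submodule.subset_span (Set.mem_range_self j)
    have hcol (j : Fin n) : hermiteColumn c j = hermiteColumn d j := by
      refine sub_eq_zero.1 ((hermiteLattice c).2.2.eq_zero_of_isTruncated
        (Submodule.sub_mem _ (hmem c j) (hcd ▸ hmem d j)) fun i => ?_)
      rw [Pi.sub_apply]
      rcases lt_trichotomy i j with h | rfl | h
      · rw [hermiteColumn_of_lt c h, hermiteColumn_of_lt d h]
        exact (isTruncated_ofCoeffs _).sub (isTruncated_ofCoeffs _)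
      · simp [hermiteColumn_self, IsTruncated.zero]
      · simp [hermiteColumn_of_gt _ j i h, IsTruncated.zero]
    funext ⟨i, m, j, hj⟩
    have h := congrArg (coeff (m : ℕ)) (congrFun (hcol j) i)
    rwa [hermiteColumn_of_lt c (Finset.mem_Ioi.1 hj), hermiteColumn_of_lt d (Finset.mem_Ioi.1 hj),
      coeff_ofCoeffs, coeff_ofCoeffs] at h
  · rintro ⟨R, hL, hR⟩
    choose g hgR hg hg0 hred using hR.exists_generator
    refine ⟨fun x => coeff x.2.1 (g x.2.2 x.1), Subtype.ext ?_⟩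
    refine Eq.trans ?_ (hR.eq_span hgR hg hg0).symm
    have : hermiteColumn (fun x : HermiteIndex α => coeff x.2.1 (g x.2.2 x.1)) = g := by
      funext j i
      rcases lt_trichotomy i j with h | rfl | h
      · rw [hermiteColumn_of_lt _ h]
        exact (hred j i h).ofCoeffs_eq
      · rw [hermiteColumn_self, hg]
      · rw [hermiteColumn_of_gt _ j i h, hg0 j i h]
    exact congrArg (fun g => Submodule.span (PowerSeries K) (Set.range g)) this

end Hermite

variable (K)

/-- The set of lattices in `S_α` is in bijection with the affine space `K^N`,
`N = Σ_{i=1}^n α_i (n − i)`. -/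
theorem stmt3 {n : ℕ} (α : Fin n → ℕ) :
    Nonempty
      ({R : Submodule (PowerSeries K) (Fin n → PowerSeries K) //
          IsLattice K R ∧ MemS K α R} ≃
        (Fin (∑ i : Fin n, α i * (n - 1 - (i : ℕ))) → K)) := by
  have hcard : Fintype.card (HermiteIndex α) = ∑ i : Fin n, α i * (n - 1 - (i : ℕ)) := by
    simp only [HermiteIndex, Fintype.card_sigma, Fintype.card_prod, Fintype.card_fin,
      Fintype.card_coe, Fin.card_Ioi]
  exact ⟨(Equiv.ofBijective _ (hermiteLattice_bijective K α)).symm.trans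
    (Equiv.arrowCongr (Fintype.equivFinOfCardEq hcard) (Equiv.refl K))⟩

end
end

section
/- Let μ = (μ_1 ≥ ⋯ ≥ μ_n ≥ 0) and λ = (λ_1 ≥ ⋯ ≥ λ_n ≥ 0) be two decreasing tuples of natural numbers with μ_1+⋯+μ_n = λ_1+⋯+λ_n = d. If there exists a lattice R in O^n belonging both to S_λ and to X_μ, then for every i = 1,…,n one has λ_{n−i+1}+⋯+λ_n ≥ μ_{n−i+1}+⋯+μ_n; equivalently μ_1+⋯+μ_i ≥ λ_1+⋯+λ_i for all i. In particular, if μ ≤ λ in the dominance order and μ ≠ λ, then no lattice belongs to both S_λ and X_μ. -/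
open PowerSeries

noncomputable section

variable (K : Type*) [Field K]

/-- Among all sets of the same size, an upper set minimises the sum of an antitone function. -/
theorem sum_upperSet_le_sum_of_card_eq {ι : Type*} [LinearOrder ι] {μ : ι → ℕ}
    (hμ : Antitone μ) {s t : Finset ι} (hs : IsUpperSet (s : Set ι)) (hst : s.card = t.card) :
    ∑ j ∈ s, μ j ≤ ∑ j ∈ t, μ j := by
  have hcard : (s \ t).card = (t \ s).card := Finset.card_sdiff_comm hst
  have hdiff : ∑ j ∈ s \ t, μ j ≤ ∑ j ∈ t \ s, μ j := by
    let e := Finset.equivOfCardEq hcard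
    rw [← Finset.sum_coe_sort (s \ t), ← Finset.sum_coe_sort (t \ s), ← Equiv.sum_comp e]
    refine Finset.sum_le_sum fun j _ => hμ ?_
    have hj := Finset.mem_sdiff.1 j.2
    have hej := Finset.mem_sdiff.1 (e j).2
    exact le_of_not_ge fun h => hej.2 (hs h hj.1)
  rw [← Finset.sum_sdiff (Finset.inter_subset_left : s ∩ t ⊆ s),
    ← Finset.sum_sdiff (Finset.inter_subset_right : s ∩ t ⊆ t),
    Finset.sdiff_inter_self_left, Finset.sdiff_inter_self_right]
  exact Nat.add_le_add_right hdiff _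

/-- A common divisor of the products of the diagonal entries `c (f j)`, over injective `f`,
divides the determinant of `A * diagonal c * C`. -/
theorem dvd_det_mul_diagonal_mul {R m ι : Type*} [CommRing R] [Fintype m] [DecidableEq m]
    [Fintype ι] [DecidableEq ι] (A : Matrix m ι R) (c : ι → R) (C : Matrix ι m R) (r : R)
    (h : ∀ f : m → ι, Function.Injective f → r ∣ ∏ j, c (f j)) :
    r ∣ (A * Matrix.diagonal c * C).det := by
  have hrows : (A * Matrix.diagonal c * C).transpose =
      fun j => ∑ l, (C l j * c l) • A.transpose l := by
    ext j i
    simp only [Matrix.transpose_apply, Matrix.mul_apply (M := A * Matrix.diagonal c),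
      Matrix.mul_diagonal, Finset.sum_apply, Pi.smul_apply, smul_eq_mul]
    exact Finset.sum_congr rfl fun l _ => by ring
  rw [← Matrix.det_transpose, hrows]
  change r ∣ (Matrix.detRowAlternating (R := R)).toMultilinearMap _
  rw [MultilinearMap.map_sum]
  refine Finset.dvd_sum fun f _ => ?_
  rw [MultilinearMap.map_smul_univ]
  by_cases hf : Function.Injective f
  · rw [Finset.prod_mul_distrib, smul_eq_mul]
    exact ((h f hf).mul_left _).mul_right _
  · have hzero : (Matrix.detRowAlternating (R := R)).toMultilinearMap
        (fun j => A.transpose (f j)) = 0 := by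
      obtain ⟨i, j, hij, hne⟩ := Function.not_injective_iff.1 hf
      exact AlternatingMap.map_eq_zero_of_eq _ _ (congrArg A.transpose hij) hne
    rw [hzero, smul_zero]
    exact dvd_zero r

/-- If a lattice lies in both `S_α` and `X_μ`, sums of `μ` over upper sets are bounded by
those of `α`. -/
theorem sum_upperSet_le_of_memS_of_memX {n : ℕ} {μ α : Fin n → ℕ} (hμ : Antitone μ)
    {R : Submodule (PowerSeries K) (Fin n → PowerSeries K)} (hS : MemS K α R)
    (hX : MemX K μ R) {s : Finset (Fin n)} (hs : IsUpperSet (s : Set (Fin n))) :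
    ∑ j ∈ s, μ j ≤ ∑ j ∈ s, α j := by
  obtain ⟨g, rfl⟩ := hX
  have hb : ∀ j : Fin n, ∃ v : Fin n → PowerSeries K,
      (∀ i, j < i → ((g.val * Matrix.diagonal fun i => X ^ μ i).mulVec v) i = 0) ∧
        ((g.val * Matrix.diagonal fun i => X ^ μ i).mulVec v) j = X ^ α j := by
    intro j
    have hmem : (X ^ α j : PowerSeries K) ∈ Submodule.span (PowerSeries K) {X ^ α j} :=
      Submodule.mem_span_singleton_self _
    rw [← hS j] at hmem
    obtain ⟨_, ⟨⟨v, rfl⟩, hw⟩, hj⟩ := hmem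
    exact ⟨v, hw, hj⟩
  choose v hv hv' using hb
  let D : Matrix (Fin n) (Fin n) (PowerSeries K) := Matrix.diagonal fun i => X ^ μ i
  let A : Matrix s (Fin n) (PowerSeries K) := fun i => g.val i
  let C : Matrix (Fin n) s (PowerSeries K) := fun l j => v j l
  have hentry (i j : s) : (A * D * C) i j =
      ((g.val * Matrix.diagonal fun i => X ^ μ i).mulVec (v j)) i := rfl
  have hdet : (A * D * C).det = X ^ ∑ j ∈ s, α j := by
    rw [Matrix.det_of_isUpperTriangular fun i j hij => (hentry i j).trans (hv j i hij),
      ← Finset.prod_pow_eq_pow_sum,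
      ← Finset.prod_coe_sort s fun j => (X : PowerSeries K) ^ α j]
    exact Finset.prod_congr rfl fun j _ => (hentry j j).trans (hv' j)
  have hdvd : (X : PowerSeries K) ^ (∑ j ∈ s, μ j) ∣ X ^ ∑ j ∈ s, α j := by
    rw [← hdet]
    refine dvd_det_mul_diagonal_mul _ _ _ _ fun f hf => ?_
    rw [Finset.prod_pow_eq_pow_sum]
    refine pow_dvd_pow _ ?_
    have hle := sum_upperSet_le_sum_of_card_eq hμ hs
      (t := Finset.univ.map ⟨f, hf⟩) (by simp)
    rwa [Finset.sum_map] at hle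
  exact (pow_dvd_pow_iff X_ne_zero X_prime.not_isUnit).1 hdvd

/-- A function on `Fin n` is determined by its partial sums. -/
theorem eq_of_sum_Iic_eq {n : ℕ} {f g : Fin n → ℕ}
    (h : ∀ k, ∑ j ∈ Finset.Iic k, f j = ∑ j ∈ Finset.Iic k, g j) : f = g := by
  funext k
  induction k using WellFoundedLT.induction with
  | ind k ih =>
    have hlt : ∑ j ∈ Finset.Iio k, f j = ∑ j ∈ Finset.Iio k, g j :=
      Finset.sum_congr rfl fun j hj => ih j (Finset.mem_Iio.1 hj)
    have hk := h k
    rw [← Finset.Iio_insert, Finset.sum_insert (by simp), Finset.sum_insert (by simp)] at hk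
    omega

/-- If some lattice lies in both `S_λ` and `X_μ` (for `μ, λ` decreasing with
sum `d`) then the tail sums of `λ` dominate those of `μ`, equivalently the head sums of `μ`
dominate those of `λ`; in particular if `μ ≤ λ` in dominance order and `μ ≠ λ`, no lattice
belongs to both `S_λ` and `X_μ`. -/
theorem stmt4 {n d : ℕ} (μ lam : Fin n → ℕ) (hμ : Antitone μ) (hlam : Antitone lam)
    (hμd : ∑ i, μ i = d) (hlamd : ∑ i, lam i = d) :
    ((∃ R : Submodule (PowerSeries K) (Fin n → PowerSeries K),
        IsLattice K R ∧ MemS K lam R ∧ MemX K μ R) →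
      (∀ k : Fin n, ∑ j ∈ Finset.Ici k, μ j ≤ ∑ j ∈ Finset.Ici k, lam j) ∧
      (∀ k : Fin n, ∑ j ∈ Finset.Iic k, lam j ≤ ∑ j ∈ Finset.Iic k, μ j)) ∧
    ((∀ k : Fin n, ∑ j ∈ Finset.Iic k, μ j ≤ ∑ j ∈ Finset.Iic k, lam j) → μ ≠ lam →
      ¬ ∃ R : Submodule (PowerSeries K) (Fin n → PowerSeries K),
          IsLattice K R ∧ MemS K lam R ∧ MemX K μ R) := by
  have key : (∃ R : Submodule (PowerSeries K) (Fin n → PowerSeries K),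
        IsLattice K R ∧ MemS K lam R ∧ MemX K μ R) →
      (∀ k : Fin n, ∑ j ∈ Finset.Ici k, μ j ≤ ∑ j ∈ Finset.Ici k, lam j) ∧
      (∀ k : Fin n, ∑ j ∈ Finset.Iic k, lam j ≤ ∑ j ∈ Finset.Iic k, μ j) := by
    rintro ⟨R, -, hS, hX⟩
    refine ⟨fun k => sum_upperSet_le_of_memS_of_memX K hμ hS hX ?_, fun k => ?_⟩
    · rw [Finset.coe_Ici]
      exact isUpperSet_Ici k
    · have hupper : IsUpperSet (((Finset.Iic k)ᶜ : Finset (Fin n)) : Set (Fin n)) := by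
        rw [Finset.coe_compl, Finset.coe_Iic]
        exact (isLowerSet_Iic k).compl
      have htail := sum_upperSet_le_of_memS_of_memX K hμ hS hX hupper
      have hsplit := Finset.sum_add_sum_compl (Finset.Iic k) μ
      have hsplit' := Finset.sum_add_sum_compl (Finset.Iic k) lam
      omega
  exact ⟨key, fun hle hne hR => hne (eq_of_sum_Iic_eq fun k => (hle k).antisymm ((key hR).2 k))⟩

end
end

section
/- Let λ = (λ_1 ≥ ⋯ ≥ λ_n ≥ 0) be a decreasing tuple of natural numbers. A lattice R in O^n belongs to both S_λ and X_λ if and only if R = u·ϖ^λO^n for some matrix u ∈ N(O) (upper triangular with unit diagonal over O). Moreover, if R belongs to S_λ ∩ X_λ and x is the unique upper triangular matrix with diagonal entries ϖ^{λ_i} and polynomial entries x_{i,j} of degree < λ_i (for i < j) with R = x·O^n, then ϖ^{λ_k} divides x_{j,k} for all j < k. -/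
open PowerSeries

noncomputable section

variable (K : Type*) [Field K]

theorem UnipUpper.mulVec_apply_of_forall_lt {A : Type*} [CommRing A] {n : ℕ}
    {u : Matrix (Fin n) (Fin n) A} (hu : UnipUpper u) {d : Fin n → A} {i : Fin n}
    (hd : ∀ l, i < l → d l = 0) : (u.mulVec d) i = d i := by
  rw [Matrix.mulVec, dotProduct, Finset.sum_eq_single i]
  · rw [hu.1, one_mul]
  · intro l _ hl
    rcases lt_or_gt_of_ne hl with h | h
    · rw [hu.2 i l h, zero_mul]
    · rw [hd l h, mul_zero]
  · simp

theorem UnipUpper.eq_zero_of_mulVec_eq_zero {A : Type*} [CommRing A] {n : ℕ}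
    {u : Matrix (Fin n) (Fin n) A} (hu : UnipUpper u) {d : Fin n → A} {i : Fin n}
    (hd : ∀ l, i < l → (u.mulVec d) l = 0) : ∀ l, i < l → d l = 0 := by
  intro l
  induction l using WellFoundedGT.induction with
  | ind l ih =>
    intro hl
    rw [← hu.mulVec_apply_of_forall_lt fun m hm => ih m hm (hl.trans hm), hd l hl]

theorem UnipUpper.det_eq_one {A : Type*} [CommRing A] {n : ℕ}
    {u : Matrix (Fin n) (Fin n) A} (hu : UnipUpper u) : u.det = 1 := by
  rw [Matrix.det_of_isUpperTriangular (fun i j h => hu.2 i j h)]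
  simp [hu.1]

/-- A triangular family indexed by `S`, together with a further vector vanishing on `S`, fits into
an isomorphic copy of `K ^ S` only if the further vector is zero. -/
theorem eq_zero_of_triangular_of_mulVec_support {F : Type*} [Field F] {n : ℕ} (S : Set (Fin n))
    (t : S → Fin n → F) (w : Fin n → F) (G : Matrix (Fin n) (Fin n) F)
    (hG : Function.Injective G.mulVec)
    (ht : ∀ i, t i i = 1) (ht' : ∀ (i : S) (j : Fin n), i < j → t i j = 0)
    (hw : ∀ i ∈ S, w i = 0)
    (hGt : ∀ i, ∀ l ∉ S, G.mulVec (t i) l = 0) (hGw : ∀ l ∉ S, G.mulVec w l = 0) :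
    w = 0 := by
  classical
  by_contra hw0
  let s : Option S → Fin n → F := fun o => o.elim w t
  have hs : ∀ o, ∀ l ∉ S, G.mulVec (s o) l = 0 := by
    rintro (_ | i)
    · exact hGw
    · exact hGt i
  have hli : LinearIndependent F fun o (l : S) => G.mulVec (s o) l := by
    rw [Fintype.linearIndependent_iff]
    intro a ha
    have hsum : ∑ o, a o • s o = 0 := by
      apply hG
      rw [Matrix.mulVec_zero, Matrix.mulVec_sum]
      funext l
      by_cases hl : l ∈ S
      · simpa [Matrix.mulVec_smul] using congrFun ha ⟨l, hl⟩
      · simp [Matrix.mulVec_smul, hs _ l hl]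
    rw [Fintype.sum_option] at hsum
    have hsome : ∀ i, a (some i) = 0 := by
      intro i
      induction i using WellFoundedGT.induction with
      | ind i ih =>
        have h := congrFun hsum i
        simp only [Pi.add_apply, Pi.smul_apply, Finset.sum_apply, s, Option.elim, hw i i.2,
          smul_zero, zero_add, Pi.zero_apply] at h
        rw [Finset.sum_eq_single i] at h
        · simpa [ht] using h
        · intro l _ hl
          rcases lt_or_gt_of_ne hl with h | h
          · rw [ht' l i h, smul_zero]
          · rw [ih l h, zero_smul]
        · simp
    rintro (_ | i)
    · simpa [hsome, s, hw0] using hsum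
    · exact hsome i
  have := hli.fintype_card_le_finrank
  simp at this

variable {K} in
/-- The columns of a triangular basis of a lattice in `X_λ` are divisible by their pivots. -/
theorem X_pow_dvd_of_triangular_of_memX {n : ℕ} {lam : Fin n → ℕ} (hlam : Antitone lam)
    {R : Submodule (PowerSeries K) (Fin n → PowerSeries K)} (hX : MemX K lam R)
    {y : Matrix (Fin n) (Fin n) (PowerSeries K)} (hdiag : ∀ i, y i i = X ^ lam i)
    (hlow : ∀ i j : Fin n, j < i → y i j = 0) (hy : ∀ k, (fun j => y j k) ∈ R) (k j : Fin n) :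
    X ^ lam k ∣ y j k := by
  classical
  obtain ⟨g, rfl⟩ := hX
  induction k using WellFoundedGT.induction generalizing j with
  | ind k ih =>
  by_contra hj
  have hex : ∃ m, ¬ ∀ j, (X : PowerSeries K) ^ m ∣ y j k := ⟨lam k, fun h => hj (h j)⟩
  obtain ⟨v, hv⟩ : ∃ v, Nat.find hex = v + 1 :=
    Nat.exists_eq_succ_of_ne_zero fun h => (Nat.find_eq_zero hex).1 h fun j => by simp
  have hvk : v < lam k := by
    have := Nat.find_min' hex fun h => hj (h j)
    omega
  have hdvd : ∀ j, (X : PowerSeries K) ^ v ∣ y j k :=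
    not_not.1 (Nat.find_min hex (by omega : v < Nat.find hex))
  have hndvd := Nat.find_spec hex
  rw [hv] at hndvd
  choose w hw using hdvd
  let S : Set (Fin n) := {i | lam i ≤ v}
  have hS : ∀ i ∈ S, k < i := fun i hi => by
    by_contra h
    exact absurd (hlam (not_lt.1 h)) (not_le.2 (lt_of_le_of_lt hi hvk))
  choose q hq using fun (i : S) (j : Fin n) => ih i (hS i i.2) j
  have hX0 : ∀ m : ℕ, (X : PowerSeries K) ^ m ≠ 0 := fun m => pow_ne_zero _ X_ne_zero
  let c0 := constantCoeff (R := K)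
  let G := ((g⁻¹ : GL (Fin n) (PowerSeries K)) : Matrix (Fin n) (Fin n) (PowerSeries K))
  have hGg : G * (g : Matrix (Fin n) (Fin n) (PowerSeries K)) = 1 := by
    rw [← Units.val_mul, inv_mul_cancel, Units.val_one]
  have hgG : (g : Matrix (Fin n) (Fin n) (PowerSeries K)) * G = 1 := by
    rw [← Units.val_mul, mul_inv_cancel, Units.val_one]
  have hsupp : ∀ z : Fin n → PowerSeries K,
      (X : PowerSeries K) ^ v • z ∈ LinearMap.range (Matrix.mulVecLin
        ((g : Matrix (Fin n) (Fin n) (PowerSeries K)) * Matrix.diagonal fun i => X ^ lam i)) →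
      ∀ l ∉ S, (G.map c0).mulVec (c0 ∘ z) l = 0 := by
    rintro z ⟨c, hc⟩ l hl
    have h := congrArg (fun x => G.mulVec x l) hc
    simp only [Matrix.mulVecLin_apply, Matrix.mulVec_mulVec, ← mul_assoc, hGg, one_mul,
      Matrix.mulVec_smul, Matrix.mulVec_diagonal, Pi.smul_apply, smul_eq_mul] at h
    obtain ⟨d, hd⟩ := Nat.exists_eq_add_of_lt (not_le.1 hl : v < lam l)
    rw [hd, add_assoc, pow_add, mul_assoc] at h
    have h' := mul_left_cancel₀ (hX0 v) h
    rw [← RingHom.map_mulVec c0 G z l, ← h']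
    simp [c0]
  have hw0 : c0 ∘ w = 0 := by
    refine eq_zero_of_triangular_of_mulVec_support S (fun i => c0 ∘ q i) (c0 ∘ w) (G.map c0)
      ?_ ?_ ?_ ?_ ?_ ?_
    · refine Function.LeftInverse.injective
        (g := ((g : Matrix (Fin n) (Fin n) (PowerSeries K)).map c0).mulVec) fun z => ?_
      rw [Matrix.mulVec_mulVec, ← Matrix.map_mul, hgG, Matrix.map_one _ (map_zero _) (map_one _),
        Matrix.one_mulVec]
    · intro i
      have h := hq i i
      rw [hdiag] at h
      have : q i i = 1 := mul_left_cancel₀ (hX0 (lam i)) (by rw [← h, mul_one])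
      simp [this]
    · intro i j hij
      have h := hq i j
      rw [hlow j i hij] at h
      simp [(mul_eq_zero.1 h.symm).resolve_left (hX0 _)]
    · intro i hi
      have h := hw i
      rw [hlow i k (hS i hi)] at h
      simp [(mul_eq_zero.1 h.symm).resolve_left (hX0 _)]
    · intro i
      refine hsupp _ ?_
      convert Submodule.smul_mem _ ((X : PowerSeries K) ^ (v - lam i)) (hy i) using 1
      funext j
      simp only [Pi.smul_apply, smul_eq_mul, hq i j, ← mul_assoc, ← pow_add]
      rw [Nat.sub_add_cancel i.2]
    · refine hsupp _ ?_
      convert hy k using 1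
      funext j
      exact (hw j).symm
  refine hndvd fun j => ?_
  rw [hw j, pow_succ]
  exact mul_dvd_mul_left _ (X_dvd_iff.2 (congrFun hw0 j))

variable {K} in
/-- A lattice in `S_λ` has an upper triangular basis with pivots `ϖ ^ λ_i`. -/
theorem MemS.exists_triangular {n : ℕ} {lam : Fin n → ℕ}
    {R : Submodule (PowerSeries K) (Fin n → PowerSeries K)} (hS : MemS K lam R) :
    ∃ y : Matrix (Fin n) (Fin n) (PowerSeries K), (∀ i, y i i = X ^ lam i) ∧
      (∀ i j : Fin n, j < i → y i j = 0) ∧ (∀ k, (fun j => y j k) ∈ R) ∧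
      LinearMap.range y.mulVecLin = R := by
  have h : ∀ i, ∃ r ∈ R ⊓ coordsLE K i, r i = X ^ lam i := fun i => by
    have : (X : PowerSeries K) ^ lam i ∈ Submodule.map (LinearMap.proj i) (R ⊓ coordsLE K i) := by
      rw [hS i]
      exact Submodule.mem_span_singleton_self _
    exact this
  choose r hr hri using h
  refine ⟨Matrix.of fun j i => r i j, hri, fun i j hij => (hr j).2 i hij, fun k => (hr k).1, ?_⟩
  rw [Matrix.range_mulVecLin]
  refine le_antisymm (Submodule.span_le.2 ?_) ?_
  · rintro _ ⟨k, rfl⟩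
    exact (hr k).1
  · have key : ∀ m ≤ n, ∀ z ∈ R, (∀ j : Fin n, m ≤ j → z j = 0) →
        z ∈ Submodule.span (PowerSeries K) (Set.range r) := by
      intro m
      induction m with
      | zero =>
        intro _ z _ hz
        rw [show z = 0 from funext fun j => hz j (Nat.zero_le _)]
        exact zero_mem _
      | succ m ih =>
        intro hm z hzR hz
        let i : Fin n := ⟨m, hm⟩
        have hzi : z i ∈ Submodule.span (PowerSeries K) {(X : PowerSeries K) ^ lam i} := by
          rw [← hS i]
          exact ⟨z, ⟨hzR, fun j hj => hz j hj⟩, rfl⟩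
        obtain ⟨c, hc⟩ := Submodule.mem_span_singleton.1 hzi
        have hri' : r i ∈ Submodule.span (PowerSeries K) (Set.range r) :=
          Submodule.subset_span ⟨i, rfl⟩
        rw [← Submodule.sub_mem_iff_left _ (Submodule.smul_mem _ c hri')]
        refine ih (by omega) _ (sub_mem hzR (Submodule.smul_mem _ c (hr i).1)) fun j hj => ?_
        rcases hj.eq_or_lt with h | h
        · obtain rfl : i = j := Fin.ext h
          simp [hri, ← hc]
        · simp [hz j h, (hr i).2 j h]
    exact fun z hz => key n le_rfl z hz fun j hj => absurd j.2 (not_lt.2 hj)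

theorem UnipUpper.memX {n : ℕ} {u : Matrix (Fin n) (Fin n) (PowerSeries K)} (hu : UnipUpper u)
    (lam : Fin n → ℕ) :
    MemX K lam (LinearMap.range (Matrix.mulVecLin (u * Matrix.diagonal fun i => X ^ lam i))) :=
  ⟨Matrix.GeneralLinearGroup.mk'' u (by rw [hu.det_eq_one]; exact isUnit_one), rfl⟩

theorem UnipUpper.memS {n : ℕ} {u : Matrix (Fin n) (Fin n) (PowerSeries K)} (hu : UnipUpper u)
    (lam : Fin n → ℕ) :
    MemS K lam (LinearMap.range (Matrix.mulVecLin (u * Matrix.diagonal fun i => X ^ lam i))) := by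
  intro i
  refine le_antisymm ?_ ?_
  · rintro _ ⟨_, ⟨⟨c, rfl⟩, hc⟩, rfl⟩
    rw [Matrix.mulVecLin_apply, ← Matrix.mulVec_mulVec] at hc ⊢
    rw [LinearMap.proj_apply,
      hu.mulVec_apply_of_forall_lt (hu.eq_zero_of_mulVec_eq_zero hc), Matrix.mulVec_diagonal]
    exact Submodule.mem_span_singleton.2 ⟨c i, mul_comm _ _⟩
  · rw [Submodule.span_singleton_le_iff_mem]
    refine ⟨_, ⟨⟨Pi.single i 1, rfl⟩, fun j hj => ?_⟩, ?_⟩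
    · simp [hu.2 j i hj]
    · simp [hu.1]

/-- For `λ` decreasing, a lattice `R` lies in `S_λ ∩ X_λ` iff `R = u·ϖ^λ·O^n`
for some `u ∈ N(O)`; moreover if `R ∈ S_λ ∩ X_λ` and `x` is the (unique) triangular matrix of
Statement 0 with `R = x·O^n`, then `ϖ^{λ_k} ∣ x_{j,k}` for all `j < k`. -/
theorem stmt5 {n : ℕ} (lam : Fin n → ℕ) (hlam : Antitone lam)
    (R : Submodule (PowerSeries K) (Fin n → PowerSeries K)) (hR : IsLattice K R) :
    (MemS K lam R ∧ MemX K lam R ↔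
      ∃ u : Matrix (Fin n) (Fin n) (PowerSeries K), UnipUpper u ∧
        LinearMap.range
          (Matrix.mulVecLin (u * Matrix.diagonal fun i => X ^ lam i)) = R) ∧
    (MemS K lam R → MemX K lam R →
      ∀ x : Matrix (Fin n) (Fin n) (PowerSeries K),
        ((∀ i, x i i = X ^ lam i) ∧
         (∀ i j : Fin n, j < i → x i j = 0) ∧
         (∀ i j : Fin n, i < j →
           ∃ p : Polynomial K, p.degree < (lam i : WithBot ℕ) ∧ x i j = (p : PowerSeries K)) ∧
         LinearMap.range x.mulVecLin = R) →
        ∀ j k : Fin n, j < k → X ^ lam k ∣ x j k) := by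
  constructor
  · constructor
    · rintro ⟨hS, hX⟩
      obtain ⟨y, hdiag, hlow, hy, hyR⟩ := hS.exists_triangular
      choose u hu using fun j k => X_pow_dvd_of_triangular_of_memX hlam hX hdiag hlow hy k j
      have hX0 : ∀ m : ℕ, (X : PowerSeries K) ^ m ≠ 0 := fun m => pow_ne_zero _ X_ne_zero
      refine ⟨Matrix.of u, ⟨fun i => ?_, fun i j hij => ?_⟩, ?_⟩
      · exact mul_left_cancel₀ (hX0 (lam i)) (by rw [Matrix.of_apply, ← hu, hdiag, mul_one])
      · have h := hu i j
        rw [hlow i j hij] at h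
        exact (mul_eq_zero.1 h.symm).resolve_left (hX0 _)
      · rw [← hyR]
        congr 2
        ext1 j k
        rw [Matrix.mul_diagonal, Matrix.of_apply, hu, mul_comm]
    · rintro ⟨u, hu, rfl⟩
      exact ⟨hu.memS K lam, hu.memX K lam⟩
  · rintro - hX x ⟨hdiag, hlow, -, hx⟩ j k -
    refine X_pow_dvd_of_triangular_of_memX hlam hX hdiag hlow (fun i => ?_) k j
    rw [← hx, Matrix.range_mulVecLin]
    exact Submodule.subset_span ⟨i, rfl⟩

end
end

section
/- Let λ = (λ_1 ≥ ⋯ ≥ λ_n ≥ 0) be a decreasing tuple of natural numbers. The set of lattices in O^n belonging to both S_λ and X_λ is in bijection with the affine space K^m, where m = Σ_{i=1}^n λ_i(n+1−2i). -/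
open PowerSeries

noncomputable section

variable (K : Type*) [Field K]

variable {K}

/-- Vectors all of whose coordinates are polynomials of degree less than the given bounds. -/
def Reduced {n : ℕ} (α : Fin n → ℕ) (v : Fin n → PowerSeries K) : Prop :=
  ∀ j k, α j ≤ k → coeff k (v j) = 0

theorem MemS.eq_zero_of_reduced {n : ℕ} {α : Fin n → ℕ}
    {R : Submodule (PowerSeries K) (Fin n → PowerSeries K)} (hR : MemS K α R)
    {v : Fin n → PowerSeries K} (hv : v ∈ R) (hred : Reduced α v) : v = 0 := by
  have key : ∀ j, v j = 0 := by
    intro j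
    induction j using WellFoundedGT.induction with
    | _ j ih =>
      have hmem : v j ∈ Submodule.map (LinearMap.proj j) (R ⊓ coordsLE K j) :=
        ⟨v, ⟨hv, ih⟩, rfl⟩
      rw [hR j, Submodule.mem_span_singleton] at hmem
      obtain ⟨a, ha⟩ := hmem
      have hd : X ^ α j ∣ v j := ⟨a, by rw [← ha, smul_eq_mul, mul_comm]⟩
      ext k
      rcases lt_or_ge k (α j) with h | h
      · simpa using X_pow_dvd_iff.1 hd k h
      · simpa using hred j k h
  exact funext key

theorem MemS.exists_pivot {n : ℕ} {α : Fin n → ℕ}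
    {R : Submodule (PowerSeries K) (Fin n → PowerSeries K)} (hR : MemS K α R) (i : Fin n) :
    ∃ a ∈ R, (∀ j, i < j → a j = 0) ∧ a i = X ^ α i := by
  have h : (X ^ α i : PowerSeries K) ∈
      Submodule.map (LinearMap.proj i) (R ⊓ coordsLE K i) := by
    rw [hR i]; exact Submodule.mem_span_singleton_self _
  obtain ⟨a, ⟨h1, h2⟩, h3⟩ := h
  exact ⟨a, h1, h2, h3⟩

theorem MemS.exists_sub_reduced {n : ℕ} {α : Fin n → ℕ}
    {R : Submodule (PowerSeries K) (Fin n → PowerSeries K)} (hR : MemS K α R) (i : ℕ)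
    (v : Fin n → PowerSeries K) (hv : ∀ j : Fin n, i ≤ j → v j = 0) :
    ∃ w ∈ R, (∀ j : Fin n, i ≤ j → w j = 0) ∧ Reduced α (v - w) := by
  induction i generalizing v with
  | zero =>
    refine ⟨0, R.zero_mem, fun _ _ => rfl, fun j k _ => ?_⟩
    simp [hv j (Nat.zero_le _)]
  | succ i ih =>
    by_cases hi : i < n
    swap
    · obtain ⟨w, hw, h1, h2⟩ := ih v fun j hj => absurd j.2 (by omega)
      exact ⟨w, hw, fun j hj => h1 j (by omega), h2⟩
    obtain ⟨a, ha, ha0, hai⟩ := hR.exists_pivot ⟨i, hi⟩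
    set i' : Fin n := ⟨i, hi⟩ with hi'
    set t : PowerSeries K := (trunc (α i') (v i')).toPowerSeries with ht
    have hd : X ^ α i' ∣ v i' - t := by
      rw [X_pow_dvd_iff]
      intro m hm
      simp [ht, Polynomial.coeff_coe, coeff_trunc, hm]
    obtain ⟨q, hq⟩ := hd
    obtain ⟨w, hw, h1, h2⟩ := ih (v - q • a - Pi.single i' t) (by
      intro j hj
      by_cases hji : j = i'
      · subst hji
        simp only [Pi.sub_apply, Pi.smul_apply, hai, smul_eq_mul, Pi.single_eq_same]
        linear_combination hq
      · have hlt : i' < j := lt_of_le_of_ne (by simpa [hi', Fin.le_def] using hj) (Ne.symm hji)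
        have : v j = 0 := hv j hlt
        simp [this, ha0 j hlt, hji])
    refine ⟨q • a + w, R.add_mem (R.smul_mem _ ha) hw, fun j hj => ?_, fun j k hk => ?_⟩
    · simp [ha0 j (show i' < j from hj), h1 j (by omega)]
    · set s : Fin n → PowerSeries K := Pi.single i' t with hs
      have h3 := h2 j k hk
      have h4 : coeff k (s j) = 0 := by
        by_cases hji : j = i'
        · subst hji
          simp [hs, ht, Polynomial.coeff_coe, coeff_trunc, hk]
        · simp [hs, hji]
      have : (v - (q • a + w)) j =
          (v - q • a - s - w) j + s j := by
        simp only [Pi.sub_apply, Pi.add_apply]; ring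
      rw [this, map_add, h3, h4, add_zero]

theorem MemS.eq_of_le {n : ℕ} {α : Fin n → ℕ}
    {R R' : Submodule (PowerSeries K) (Fin n → PowerSeries K)} (hR : MemS K α R)
    (hR' : MemS K α R') (hle : R' ≤ R) : R' = R := by
  refine le_antisymm hle fun v hv => ?_
  obtain ⟨w, hw, -, hred⟩ := hR'.exists_sub_reduced n v fun j hj => absurd j.2 (by omega)
  have := hR.eq_zero_of_reduced (R.sub_mem hv (hle hw)) hred
  rwa [sub_eq_zero.1 this]

/-- Upper triangular matrices with diagonal entries `X ^ α i`. -/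
def IsPivotal {n : ℕ} (α : Fin n → ℕ) (M : Matrix (Fin n) (Fin n) (PowerSeries K)) : Prop :=
  (∀ i, M i i = X ^ α i) ∧ ∀ i j, j < i → M i j = 0

theorem IsPivotal.eq_zero {n : ℕ} {α : Fin n → ℕ}
    {M : Matrix (Fin n) (Fin n) (PowerSeries K)} (hM : IsPivotal α M)
    {x : Fin n → PowerSeries K} {i : Fin n} (hx : ∀ j, i < j → M.mulVec x j = 0) :
    ∀ j, i < j → x j = 0 := by
  intro j
  induction j using WellFoundedGT.induction with
  | _ j ih =>
    intro hij
    have h := hx j hij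
    rw [Matrix.mulVec, dotProduct, Finset.sum_eq_single j, hM.1] at h
    · exact (mul_eq_zero.1 h).resolve_left (pow_ne_zero _ X_ne_zero)
    · intro k _ hk
      rcases lt_or_gt_of_ne hk with h' | h'
      · simp [hM.2 j k h']
      · simp [ih k h' (hij.trans h')]
    · simp

theorem IsPivotal.memS {n : ℕ} {α : Fin n → ℕ}
    {M : Matrix (Fin n) (Fin n) (PowerSeries K)} (hM : IsPivotal α M) :
    MemS K α (LinearMap.range M.mulVecLin) := by
  intro i
  apply le_antisymm
  · rintro _ ⟨_, ⟨⟨x, rfl⟩, hx⟩, rfl⟩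
    have hx0 := hM.eq_zero (x := x) (i := i) hx
    rw [Submodule.mem_span_singleton]
    refine ⟨x i, ?_⟩
    simp only [LinearMap.proj_apply, Matrix.mulVecLin_apply, Matrix.mulVec, dotProduct]
    rw [Finset.sum_eq_single i, hM.1, smul_eq_mul, mul_comm]
    · intro k _ hk
      rcases lt_or_gt_of_ne hk with h' | h'
      · simp [hM.2 i k h']
      · simp [hx0 k h']
    · simp
  · rw [Submodule.span_singleton_le_iff_mem]
    refine ⟨fun j => M j i, ⟨⟨Pi.single i 1, ?_⟩, fun j hj => hM.2 j i hj⟩, hM.1 i⟩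
    ext1 j
    simp

theorem isLattice_of_smul_mem {n : ℕ}
    {R : Submodule (PowerSeries K) (Fin n → PowerSeries K)} (N : ℕ)
    (h : ∀ v : Fin n → PowerSeries K, (X ^ N : PowerSeries K) • v ∈ R) : IsLattice K R := by
  let φ : (Fin n → PowerSeries K) →ₗ[K] (Fin n → Fin N → K) :=
    LinearMap.pi fun i => LinearMap.pi fun k => (coeff (k : ℕ)).comp (LinearMap.proj i)
  have hker : LinearMap.ker φ ≤ R.restrictScalars K := by
    intro v hv
    have hd : ∀ i, X ^ N ∣ v i := fun i => by
      rw [X_pow_dvd_iff]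
      intro m hm
      exact congrFun (congrFun (LinearMap.mem_ker.1 hv) i) ⟨m, hm⟩
    choose w hw using hd
    have : v = (X ^ N : PowerSeries K) • w := funext hw
    rw [this]
    exact h w
  have : FiniteDimensional K ((Fin n → PowerSeries K) ⧸ LinearMap.ker φ) :=
    LinearEquiv.finiteDimensional φ.quotKerEquivRange.symm
  exact Module.Finite.of_surjective (Submodule.factor hker) (Submodule.factor_surjective hker)

theorem MemX.isLattice {n : ℕ} {μ : Fin n → ℕ}
    {R : Submodule (PowerSeries K) (Fin n → PowerSeries K)} (hR : MemX K μ R) :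
    IsLattice K R := by
  obtain ⟨g, rfl⟩ := hR
  refine isLattice_of_smul_mem (∑ i, μ i) fun v => ?_
  set D : Matrix (Fin n) (Fin n) (PowerSeries K) := Matrix.diagonal fun i => X ^ μ i with hD
  have hdet : D.det = X ^ ∑ i, μ i := by
    rw [hD, Matrix.det_diagonal, Finset.prod_pow_eq_pow_sum]
  have hg : (g : Matrix (Fin n) (Fin n) (PowerSeries K)) * (↑g⁻¹ : Matrix _ _ _) = 1 :=
    Units.mul_inv g
  refine ⟨(D.adjugate * (↑g⁻¹ : Matrix _ _ _)).mulVec v, ?_⟩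
  rw [Matrix.mulVecLin_apply, Matrix.mulVec_mulVec, ← mul_assoc, mul_assoc _ D,
    Matrix.mul_adjugate, hdet, mul_smul_comm, smul_mul_assoc, mul_one, hg, Matrix.smul_mulVec,
    Matrix.one_mulVec]

theorem sum_Ici_le_sum_of_injective {n : ℕ} {lam : Fin n → ℕ} (hlam : Antitone lam) (i : Fin n)
    {f : {k : Fin n // i ≤ k} → Fin n} (hf : Function.Injective f) :
    ∑ k : {k : Fin n // i ≤ k}, lam k ≤ ∑ k, lam (f k) := by
  classical
  set S : Finset (Fin n) := Finset.univ.image f with hS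
  set T : Finset (Fin n) := Finset.univ.filter (i ≤ ·) with hT
  have h1 : ∑ k, lam (f k) = ∑ k ∈ S, lam k := by
    rw [hS, Finset.sum_image fun a _ b _ h => hf h]
  have h2 : ∑ k : {k : Fin n // i ≤ k}, lam k = ∑ k ∈ T, lam k :=
    (Finset.sum_subtype T (by simp [hT]) lam).symm
  have hcard : S.card = T.card := by
    rw [hS, Finset.card_image_of_injective _ hf, Finset.card_univ, Fintype.card_subtype]
  rw [h1, h2, ← Finset.sum_sdiff_le_sum_sdiff]
  calc ∑ k ∈ T \ S, lam k ≤ (T \ S).card • lam i :=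
        Finset.sum_le_card_nsmul _ _ _ fun k hk => hlam (by simp [hT] at hk; exact hk.1)
    _ = (S \ T).card • lam i := by rw [Finset.card_sdiff_comm hcard]
    _ ≤ ∑ k ∈ S \ T, lam k :=
        Finset.card_nsmul_le_sum _ _ _ fun k hk => hlam (by simp [hT] at hk; exact hk.2.le)

theorem X_pow_dvd_det_mul_diagonal_mul {n : ℕ} {lam : Fin n → ℕ} (hlam : Antitone lam) (i : Fin n)
    (G : Matrix {k : Fin n // i ≤ k} (Fin n) (PowerSeries K))
    (C : Matrix (Fin n) {k : Fin n // i ≤ k} (PowerSeries K)) :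
    X ^ ∑ k : {k : Fin n // i ≤ k}, lam k ∣
      (G * Matrix.diagonal (fun m => (X : PowerSeries K) ^ lam m) * C).det := by
  rw [← Matrix.det_transpose]
  have hrow : (G * Matrix.diagonal (fun m => (X : PowerSeries K) ^ lam m) * C).transpose =
      fun l => ∑ m, (X ^ lam m * C m l) • G.transpose m := by
    ext1 l k
    rw [Matrix.transpose_apply, Matrix.mul_apply, Finset.sum_apply]
    simp only [Matrix.transpose_apply, Matrix.mul_diagonal, Pi.smul_apply, smul_eq_mul]
    exact Finset.sum_congr rfl fun m _ => by ring
  rw [hrow]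
  change _ ∣ Matrix.detRowAlternating.toMultilinearMap _
  rw [MultilinearMap.map_sum]
  refine Finset.dvd_sum fun f _ => ?_
  rw [MultilinearMap.map_smul_univ, smul_eq_mul, Finset.prod_mul_distrib]
  by_cases hf : Function.Injective f
  · rw [Finset.prod_pow_eq_pow_sum]
    exact dvd_mul_of_dvd_left
      (dvd_mul_of_dvd_left (pow_dvd_pow _ (sum_Ici_le_sum_of_injective hlam i hf)) _) _
  · obtain ⟨a, b, hab, hne⟩ : ∃ a b, f a = f b ∧ a ≠ b := by
      simpa [Function.Injective] using hf
    have : (Matrix.detRowAlternating.toMultilinearMap fun l => G.transpose (f l)) = 0 :=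
      Matrix.detRowAlternating.map_eq_zero_of_eq _ (congrArg G.transpose hab) hne
    rw [this, mul_zero]
    exact dvd_zero _

theorem IsPivotal.X_pow_dvd {n : ℕ} {lam : Fin n → ℕ} (hlam : Antitone lam)
    {M : Matrix (Fin n) (Fin n) (PowerSeries K)} (hM : IsPivotal lam M)
    (hX : MemX K lam (LinearMap.range M.mulVecLin)) (j i : Fin n) :
    X ^ lam i ∣ M j i := by
  obtain ⟨g, hg⟩ := hX
  have hcol : ∀ l, ∃ c : Fin n → PowerSeries K,
      ((g : Matrix (Fin n) (Fin n) (PowerSeries K)) *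
        Matrix.diagonal fun i => X ^ lam i).mulVec c = fun k => M k l := by
    intro l
    have : (fun k => M k l) ∈ LinearMap.range M.mulVecLin := ⟨Pi.single l 1, by ext1 k; simp⟩
    rw [← hg] at this
    exact this
  choose c hc using hcol
  let r : {k : Fin n // i ≤ k} → Fin n := fun k => if (k : Fin n) = i then j else k
  let G : Matrix {k : Fin n // i ≤ k} (Fin n) (PowerSeries K) := Matrix.of fun k m => g.1 (r k) m
  let C : Matrix (Fin n) {k : Fin n // i ≤ k} (PowerSeries K) := Matrix.of fun m k => c k m
  have hN : G * Matrix.diagonal (fun m => (X : PowerSeries K) ^ lam m) * C =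
      M.submatrix r Subtype.val := by
    ext1 k l
    exact congrFun (hc l) (r k)
  have hdvd := X_pow_dvd_det_mul_diagonal_mul hlam i G C
  rw [hN, Matrix.det_of_isUpperTriangular, ← Finset.prod_pow_eq_pow_sum] at hdvd
  swap
  · intro k l hlk
    have hlk : (l : Fin n) < k := hlk
    have : r k = k := if_neg (l.2.trans_lt hlk).ne'
    rw [Matrix.submatrix_apply, this]
    exact hM.2 _ _ hlk
  let i₀ : {k : Fin n // i ≤ k} := ⟨i, le_rfl⟩
  rw [← Finset.mul_prod_erase _ _ (Finset.mem_univ i₀),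
    ← Finset.mul_prod_erase _ _ (Finset.mem_univ i₀)] at hdvd
  have hrest : ∏ k ∈ Finset.univ.erase i₀, M.submatrix r Subtype.val k k =
      ∏ k ∈ Finset.univ.erase i₀, (X : PowerSeries K) ^ lam k := by
    refine Finset.prod_congr rfl fun k hk => ?_
    have hne : (k : Fin n) ≠ i := fun h => (Finset.mem_erase.1 hk).1 (Subtype.ext h)
    have : r k = k := if_neg hne
    rw [Matrix.submatrix_apply, this, hM.1]
  rw [hrest] at hdvd
  have h := (mul_dvd_mul_iff_right
    (Finset.prod_ne_zero_iff.2 fun k _ => pow_ne_zero _ X_ne_zero)).1 hdvd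
  simpa [r, i₀] using h

theorem IsPivotal.memX {n : ℕ} {lam : Fin n → ℕ}
    {M : Matrix (Fin n) (Fin n) (PowerSeries K)} (hM : IsPivotal lam M)
    (hdvd : ∀ j i, j < i → X ^ lam i ∣ M j i) : MemX K lam (LinearMap.range M.mulVecLin) := by
  have hall : ∀ j i, ∃ u, M j i = u * X ^ lam i ∧ (i < j → u = 0) ∧ (j = i → u = 1) := by
    intro j i
    rcases lt_trichotomy j i with h | h | h
    · obtain ⟨u, hu⟩ := hdvd j i h
      exact ⟨u, by rw [hu, mul_comm], fun h' => absurd h' h.not_gt, fun h' => absurd h' h.ne⟩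
    · subst h
      exact ⟨1, by rw [hM.1, one_mul], fun h' => absurd h' (lt_irrefl _), fun _ => rfl⟩
    · exact ⟨0, by rw [hM.2 j i h, zero_mul], fun _ => rfl, fun h' => absurd h' h.ne'⟩
  choose u' hu hu0 hu1 using hall
  let u : Matrix (Fin n) (Fin n) (PowerSeries K) := Matrix.of u'
  have hdet : u.det = 1 := by
    rw [Matrix.det_of_isUpperTriangular (M := u) fun j i h => hu0 j i h]
    exact Finset.prod_eq_one fun i _ => hu1 i i rfl
  refine ⟨Matrix.GeneralLinearGroup.mk'' u (by rw [hdet]; exact isUnit_one), ?_⟩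
  congr 2
  ext1 j i
  rw [hu]
  exact Matrix.mul_diagonal _ u j i

/-- The positions `(j, i, k)` of the free coefficients of the normal form of a lattice. -/
def freeIndices {n : ℕ} (lam : Fin n → ℕ) : Finset (Σ _ : Fin n × Fin n, ℕ) :=
  Finset.univ.sigma fun p => Finset.Ico (lam p.2) (lam p.1)

theorem card_freeIndices {n : ℕ} {lam : Fin n → ℕ} (hlam : Antitone lam) :
    ((freeIndices lam).card : ℤ) =
      ∑ i : Fin n, (lam i : ℤ) * ((n : ℤ) - 1 - 2 * (i : ℕ)) := by
  have hsub : ∀ j i : Fin n, ((lam j - lam i : ℕ) : ℤ) =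
      (if j < i then (lam j : ℤ) else 0) - if j < i then (lam i : ℤ) else 0 := by
    intro j i
    split_ifs with h
    · rw [Nat.cast_sub (hlam h.le)]
    · simp [Nat.sub_eq_zero_of_le (hlam (not_lt.1 h))]
  simp only [freeIndices, Finset.card_sigma, Nat.card_Ico, Nat.cast_sum, Fintype.sum_prod_type,
    hsub, Finset.sum_sub_distrib]
  rw [Finset.sum_comm (f := fun j i : Fin n => if j < i then (lam i : ℤ) else 0),
    ← Finset.sum_sub_distrib]
  refine Finset.sum_congr rfl fun i _ => ?_
  rw [← Finset.sum_filter, ← Finset.sum_filter, Finset.sum_const, Finset.sum_const,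
    Finset.filter_lt_eq_Ioi, Finset.filter_gt_eq_Iio, Fin.card_Ioi, Fin.card_Iio]
  have := i.2
  simp only [nsmul_eq_mul]
  rw [Nat.sub_sub, Nat.cast_sub (by omega)]
  push_cast
  ring

/-- The normal form matrix with prescribed free coefficients. -/
def normalForm {n : ℕ} (lam : Fin n → ℕ) (c : freeIndices lam → K) :
    Matrix (Fin n) (Fin n) (PowerSeries K) :=
  Matrix.of fun j i => PowerSeries.mk fun k =>
    if h : (⟨(j, i), k⟩ : Σ _ : Fin n × Fin n, ℕ) ∈ freeIndices lam then c ⟨_, h⟩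
    else if j = i ∧ k = lam i then 1 else 0

theorem mem_freeIndices {n : ℕ} {lam : Fin n → ℕ} {j i : Fin n} {k : ℕ} :
    (⟨(j, i), k⟩ : Σ _ : Fin n × Fin n, ℕ) ∈ freeIndices lam ↔ lam i ≤ k ∧ k < lam j := by
  simp [freeIndices]

theorem coeff_normalForm {n : ℕ} {lam : Fin n → ℕ} (c : freeIndices lam → K) (j i : Fin n)
    (k : ℕ) (h : lam i ≤ k ∧ k < lam j) :
    coeff k (normalForm lam c j i) = c ⟨⟨(j, i), k⟩, mem_freeIndices.2 h⟩ := by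
  simp [normalForm, mem_freeIndices, h]

theorem coeff_normalForm_of_ne {n : ℕ} {lam : Fin n → ℕ} (c : freeIndices lam → K) {j i : Fin n}
    (hji : j ≠ i) {k : ℕ} (h : ¬(lam i ≤ k ∧ k < lam j)) :
    coeff k (normalForm lam c j i) = 0 := by
  simp only [normalForm, Matrix.of_apply, coeff_mk]
  rw [dif_neg (mem_freeIndices.not.2 h), if_neg (by simp [hji])]

theorem isPivotal_normalForm {n : ℕ} {lam : Fin n → ℕ} (hlam : Antitone lam)
    (c : freeIndices lam → K) : IsPivotal lam (normalForm lam c) := by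
  refine ⟨fun i => ?_, fun j i hij => ?_⟩
  · ext k
    simp only [normalForm, Matrix.of_apply, coeff_mk]
    rw [dif_neg (by rw [mem_freeIndices]; omega), coeff_X_pow]
    simp
  · ext k
    have := hlam hij.le
    rw [coeff_normalForm_of_ne c hij.ne' (by omega), map_zero]

theorem memX_normalForm {n : ℕ} {lam : Fin n → ℕ} (hlam : Antitone lam)
    (c : freeIndices lam → K) : MemX K lam (LinearMap.range (normalForm lam c).mulVecLin) := by
  refine (isPivotal_normalForm hlam c).memX fun j i hji => ?_
  rw [X_pow_dvd_iff]
  intro m hm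
  exact coeff_normalForm_of_ne c hji.ne (by omega)

theorem range_normalForm_injective {n : ℕ} {lam : Fin n → ℕ} (hlam : Antitone lam) :
    Function.Injective fun c : freeIndices lam → K =>
      LinearMap.range (normalForm lam c).mulVecLin := by
  intro c c' hcc
  have hcol : ∀ (d : freeIndices lam → K) (i : Fin n),
      (fun j => normalForm lam d j i) ∈ LinearMap.range (normalForm lam d).mulVecLin :=
    fun d i => ⟨Pi.single i 1, by ext1 k; simp⟩
  have heq : ∀ j i, normalForm lam c j i = normalForm lam c' j i := by
    intro j i
    have hmem : (fun j => normalForm lam c j i) - (fun j => normalForm lam c' j i) ∈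
        LinearMap.range (normalForm lam c).mulVecLin := by
      refine Submodule.sub_mem _ (hcol c i) ?_
      have := hcol c' i
      rwa [← show LinearMap.range (normalForm lam c).mulVecLin =
        LinearMap.range (normalForm lam c').mulVecLin from hcc] at this
    have hred : Reduced lam
        ((fun j => normalForm lam c j i) - (fun j => normalForm lam c' j i)) := by
      intro j k hk
      by_cases hji : j = i
      · subst hji
        simp [(isPivotal_normalForm hlam _).1]
      · rw [Pi.sub_apply, map_sub, coeff_normalForm_of_ne c hji (by omega),
          coeff_normalForm_of_ne c' hji (by omega), sub_zero]
    exact sub_eq_zero.1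
      (congrFun ((isPivotal_normalForm hlam c).memS.eq_zero_of_reduced hmem hred) j)
  funext ⟨⟨⟨j, i⟩, k⟩, h⟩
  have h' := mem_freeIndices.1 h
  rw [← coeff_normalForm c j i k h', ← coeff_normalForm c' j i k h', heq]

theorem exists_normalForm {n : ℕ} {lam : Fin n → ℕ} (hlam : Antitone lam)
    {R : Submodule (PowerSeries K) (Fin n → PowerSeries K)} (hS : MemS K lam R)
    (hX : MemX K lam R) :
    ∃ c : freeIndices lam → K, LinearMap.range (normalForm lam c).mulVecLin = R := by
  have hb : ∀ i, ∃ b ∈ R, (∀ j, i < j → b j = 0) ∧ b i = X ^ lam i ∧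
      ∀ j, j < i → ∀ k, lam j ≤ k → coeff k (b j) = 0 := by
    intro i
    obtain ⟨a, haR, ha0, hai⟩ := hS.exists_pivot i
    obtain ⟨w, hwR, hw0, hred⟩ := hS.exists_sub_reduced i (a - Pi.single i (a i)) (by
      intro j hj
      rcases eq_or_lt_of_le (show i ≤ j from hj) with h | h
      · subst h; simp
      · simp [ha0 j h, h.ne'])
    refine ⟨a - w, R.sub_mem haR hwR, fun j hj => ?_, ?_, fun j hj k hk => ?_⟩
    · simp [ha0 j hj, hw0 j hj.le]
    · simp [hai, hw0 i le_rfl]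
    · have := hred j k hk
      simpa [hj.ne] using this
  choose b hbR hb0 hbi hbred using hb
  let M : Matrix (Fin n) (Fin n) (PowerSeries K) := Matrix.of fun j i => b i j
  have hM : IsPivotal lam M := ⟨hbi, fun j i hij => hb0 i j hij⟩
  have hrange : LinearMap.range M.mulVecLin = R := by
    refine hS.eq_of_le hM.memS ?_
    rw [Matrix.range_mulVecLin, Submodule.span_le]
    rintro _ ⟨i, rfl⟩
    exact hbR i
  refine ⟨fun p => coeff p.1.2 (M p.1.1.1 p.1.1.2), ?_⟩
  rw [← hrange]
  congr 2
  set c : freeIndices lam → K := fun p => coeff p.1.2 (M p.1.1.1 p.1.1.2) with hc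
  have hN := isPivotal_normalForm hlam c
  ext j i k
  rcases lt_trichotomy j i with h | h | h
  · by_cases hk : lam i ≤ k ∧ k < lam j
    · rw [coeff_normalForm c j i k hk]
    · rw [coeff_normalForm_of_ne c h.ne hk]
      rcases lt_or_ge k (lam i) with h' | h'
      · exact (X_pow_dvd_iff.1 (hM.X_pow_dvd hlam (hrange ▸ hX) j i) k h').symm
      · exact (hbred i j h k (by omega)).symm
  · subst h
    rw [hN.1, hM.1]
  · rw [hN.2 j i h, hM.2 j i h]

variable (K)

/-- For `λ` decreasing, the set of lattices in `S_λ ∩ X_λ` is in bijection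
with the affine space `K^m`, `m = Σ_{i=1}^n λ_i (n + 1 − 2i)` (computed in `ℤ`). -/
theorem stmt6 {n : ℕ} (lam : Fin n → ℕ) (hlam : Antitone lam) :
    Nonempty
      ({R : Submodule (PowerSeries K) (Fin n → PowerSeries K) //
          IsLattice K R ∧ MemS K lam R ∧ MemX K lam R} ≃
        (Fin (∑ i : Fin n, (lam i : ℤ) * ((n : ℤ) - 1 - 2 * (i : ℕ))).toNat → K)) := by
  have hcard : (freeIndices lam).card =
      (∑ i : Fin n, (lam i : ℤ) * ((n : ℤ) - 1 - 2 * (i : ℕ))).toNat := by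
    rw [← card_freeIndices hlam, Int.toNat_natCast]
  let F : (freeIndices lam → K) →
      {R : Submodule (PowerSeries K) (Fin n → PowerSeries K) //
        IsLattice K R ∧ MemS K lam R ∧ MemX K lam R} := fun c =>
    ⟨LinearMap.range (normalForm lam c).mulVecLin, (memX_normalForm hlam c).isLattice,
      (isPivotal_normalForm hlam c).memS, memX_normalForm hlam c⟩
  have hF : Function.Bijective F :=
    ⟨fun c c' h => range_normalForm_injective hlam (congrArg Subtype.val h), fun ⟨R, _, hS, hX⟩ =>
      let ⟨c, hc⟩ := exists_normalForm hlam hS hX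
      ⟨c, Subtype.ext hc⟩⟩
  exact ⟨(Equiv.ofBijective F hF).symm.trans
    (Equiv.arrowCongr ((freeIndices lam).equivFinOfCardEq hcard) (Equiv.refl K))⟩

end
end

section
/- Let λ = (λ_1 ≥ ⋯ ≥ λ_n ≥ 0) be a decreasing tuple of natural numbers. If u, u' ∈ N(F) are upper triangular unipotent matrices over F with u·ϖ^λO^n = u'·ϖ^λO^n (as O-submodules of F^n), then Σ_{i=1}^{n−1} res(u_{i,i+1} dϖ) = Σ_{i=1}^{n−1} res(u'_{i,i+1} dϖ). -/
open PowerSeries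

noncomputable section

variable (K : Type*) [Field K]

open scoped Matrix

/-- Back substitution: if `u` is upper triangular unipotent and `u *ᵥ d` vanishes at all
coordinates `> j`, then so does `d`. -/
theorem UnipUpper.eq_zero_of_mulVec {A : Type*} [CommRing A] {n : ℕ}
    {u : Matrix (Fin n) (Fin n) A} (hu : UnipUpper u) {d : Fin n → A} {j : Fin n}
    (h : ∀ i, j < i → (u *ᵥ d) i = 0) (i : Fin n) (hi : j < i) : d i = 0 := by
  induction i using WellFoundedGT.induction with
  | ind i ih =>
    have key := h i hi
    rw [Matrix.mulVec, dotProduct, Finset.sum_eq_single i, hu.1 i, one_mul] at key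
    · exact key
    · intro k _ hk
      rcases lt_or_gt_of_ne hk with hk | hk
      · rw [hu.2 i k hk, zero_mul]
      · rw [ih k hk (hi.trans hk), mul_zero]
    · simp

theorem coeff_neg_one_algebraMap (a : PowerSeries K) :
    (algebraMap (PowerSeries K) (LaurentSeries K) a).coeff (-1) = 0 := by
  rw [LaurentSeries.coe_algebraMap, HahnSeries.ofPowerSeries_apply]
  apply HahnSeries.embDomain_of_notMem_range
  rintro ⟨m, hm⟩
  have : (m : ℤ) = -1 := hm
  omega

/-- If `u·ϖ^λ·O^n ⊆ u'·ϖ^λ·O^n` with `λ` decreasing, then the entries of `u` and `u'` just above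
the diagonal differ by elements of `O`. -/
theorem exists_superdiag_eq_add {n : ℕ} {lam : Fin n → ℕ} (hlam : Antitone lam)
    {u u' : Matrix (Fin n) (Fin n) (LaurentSeries K)}
    (hu : UnipUpper u) (hu' : UnipUpper u')
    (h : latticeOf K (u * Matrix.diagonal fun i => varpi K ^ lam i) ≤
      latticeOf K (u' * Matrix.diagonal fun i => varpi K ^ lam i))
    {i j : Fin n} (hij : (i : ℕ) + 1 = j) :
    ∃ a : PowerSeries K, u i j = u' i j + algebraMap _ _ a := by
  have hlt : i < j := by rw [Fin.lt_def]; omega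
  have hϖ : varpi K ≠ 0 := by
    rw [varpi, Ne, FaithfulSMul.algebraMap_eq_zero_iff]
    exact X_ne_zero
  have hmem := h (Submodule.subset_span (Set.mem_range_self j))
  obtain ⟨c, hc⟩ := (Submodule.mem_span_range_iff_exists_fun (PowerSeries K)).1 hmem
  set d : Fin n → LaurentSeries K := fun k => algebraMap _ _ (c k) * varpi K ^ lam k with hd
  have hmul : ∀ l, (u' *ᵥ d) l = u l j * varpi K ^ lam j := by
    intro l
    have := congrFun hc l
    simp only [Finset.sum_apply, Pi.smul_apply, Matrix.mul_diagonal] at this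
    rw [← this, Matrix.mulVec, dotProduct]
    exact Finset.sum_congr rfl fun k _ => by rw [hd, Algebra.smul_def, mul_left_comm]
  have hzero : ∀ k, j < k → d k = 0 :=
    hu'.eq_zero_of_mulVec fun l hl => by rw [hmul, hu.2 l j hl, zero_mul]
  have hj : d j = varpi K ^ lam j := by
    have := hmul j
    rw [Matrix.mulVec, dotProduct, Finset.sum_eq_single j, hu'.1, hu.1, one_mul, one_mul] at this
    · exact this
    · intro k _ hk
      rcases lt_or_gt_of_ne hk with hk | hk
      · rw [hu'.2 j k hk, zero_mul]
      · rw [hzero k hk, mul_zero]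
    · simp
  have hi := hmul i
  rw [Matrix.mulVec, dotProduct, Finset.sum_eq_add i j hlt.ne, hu'.1, one_mul, hj] at hi
  · refine ⟨c i * X ^ (lam i - lam j), mul_right_cancel₀ (pow_ne_zero (lam j) hϖ) ?_⟩
    rw [← hi, map_mul, map_pow, ← varpi, add_mul, mul_assoc, ← pow_add,
      Nat.sub_add_cancel (hlam hlt.le), add_comm]
  · rintro k _ ⟨hki, hkj⟩
    rcases lt_or_gt_of_ne hki with hk | hk
    · rw [hu'.2 i k hk, zero_mul]
    · rw [hzero k, mul_zero]
      rw [Fin.lt_def] at hk ⊢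
      have := Fin.val_ne_of_ne hkj
      omega
  · simp
  · simp

/-- For `λ` decreasing and `u, u' ∈ N(F)` with `u·ϖ^λ·O^n = u'·ϖ^λ·O^n`, the
residue sums of `u` and `u'` agree. -/
theorem stmt9 {n : ℕ} (lam : Fin n → ℕ) (hlam : Antitone lam)
    (u u' : Matrix (Fin n) (Fin n) (LaurentSeries K))
    (hu : UnipUpper u) (hu' : UnipUpper u')
    (h : latticeOf K (u * Matrix.diagonal fun i => varpi K ^ lam i) =
      latticeOf K (u' * Matrix.diagonal fun i => varpi K ^ lam i)) :
    resSum K u = resSum K u' := by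
  unfold resSum
  refine Finset.sum_congr rfl fun i _ => ?_
  split_ifs with hi
  · obtain ⟨a, ha⟩ := exists_superdiag_eq_add K hlam hu hu' h.le (i := i) (j := ⟨i + 1, hi⟩) rfl
    rw [ha, HahnSeries.coeff_add, coeff_neg_one_algebraMap, add_zero]
  · rfl

end
end

section
/- Let α = (α_1,…,α_n) ∈ ℕ^n be a tuple which is not decreasing, i.e. α_j < α_{j+1} for some j. Then there exists an upper triangular unipotent matrix u ∈ N(F) such that ϖ^{−α}·u·ϖ^α ∈ GL_n(O) and Σ_{i=1}^{n−1} res(u_{i,i+1} dϖ) ≠ 0. -/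
open PowerSeries

noncomputable section

variable (K : Type*) [Field K]

theorem varpi_eq_single : varpi K = HahnSeries.single (1 : ℤ) (1 : K) := by
  simp [varpi, LaurentSeries.coe_algebraMap]

theorem varpi_ne_zero : varpi K ≠ 0 := by
  simp [varpi_eq_single]

theorem coeff_neg_one_varpi_zpow_neg_one : (varpi K ^ (-1 : ℤ)).coeff (-1) = 1 := by
  simp [varpi_eq_single]

/-- If `α` is not decreasing, there is `u ∈ N(F)` with
`ϖ^{−α}·u·ϖ^α ∈ GL_n(O)` and `Σ res(u_{i,i+1} dϖ) ≠ 0`. -/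
theorem stmt10 {n : ℕ} (α : Fin n → ℕ)
    (hα : ∃ j : Fin n, ∃ h : (j : ℕ) + 1 < n, α j < α ⟨(j : ℕ) + 1, h⟩) :
    ∃ u : Matrix (Fin n) (Fin n) (LaurentSeries K), UnipUpper u ∧
      (∃ g : GL (Fin n) (PowerSeries K),
        (Matrix.diagonal fun i => varpi K ^ (-(α i : ℤ))) * u *
            (Matrix.diagonal fun i => varpi K ^ ((α i : ℤ))) =
          (g : Matrix (Fin n) (Fin n) (PowerSeries K)).map
            (algebraMap (PowerSeries K) (LaurentSeries K))) ∧
      resSum K u ≠ 0 := by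
  obtain ⟨j, h, hlt⟩ := hα
  set k : Fin n := ⟨(j : ℕ) + 1, h⟩ with hk
  have hjk : j < k := Fin.lt_def.2 (Nat.lt_succ_self _)
  have hv := varpi_ne_zero K
  refine ⟨Matrix.transvection j k (varpi K ^ (-1 : ℤ)), ⟨fun i => ?_, fun a b hab => ?_⟩, ?_, ?_⟩
  · have : ¬ (j = i ∧ k = i) := fun h => hjk.ne (h.1.trans h.2.symm)
    simp [Matrix.transvection, this]
  · have : ¬ (j = a ∧ k = b) := by
      rintro ⟨rfl, rfl⟩
      exact lt_asymm hab hjk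
    simp [Matrix.transvection, this, hab.ne']
  · have hu : IsUnit (Matrix.transvection j k (X ^ (α k - α j - 1) : PowerSeries K)) := by
      rw [Matrix.isUnit_iff_isUnit_det, Matrix.det_transvection_of_ne _ _ hjk.ne]
      exact isUnit_one
    refine ⟨hu.unit, ?_⟩
    ext1 a b
    rw [Matrix.mul_diagonal, Matrix.diagonal_mul, IsUnit.unit_spec, Matrix.map_apply]
    simp only [Matrix.transvection, Matrix.add_apply, Matrix.one_apply, Matrix.single_apply,
      map_add, mul_add, add_mul]
    congr 1
    · split_ifs with hab
      · subst hab
        rw [mul_one, ← zpow_add₀ hv]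
        simp
      · simp
    · split_ifs with hab
      · obtain ⟨rfl, rfl⟩ := hab
        rw [map_pow, ← zpow_add₀ hv, ← zpow_add₀ hv]
        change _ = varpi K ^ _
        rw [← zpow_natCast]
        congr 1
        omega
      · simp
  · unfold resSum
    rw [Finset.sum_eq_single j]
    · rw [dif_pos h]
      change (Matrix.transvection j k (varpi K ^ (-1 : ℤ)) j k).coeff (-1) ≠ 0
      simp only [Matrix.transvection, Matrix.add_apply, Matrix.one_apply_ne hjk.ne,
        Matrix.single_apply_same, zero_add, coeff_neg_one_varpi_zpow_neg_one]
      exact one_ne_zero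
    · intro i _ hij
      split_ifs with hi
      · have h1 : i ≠ ⟨(i : ℕ) + 1, hi⟩ := fun h => by simp [Fin.ext_iff] at h
        simp [Matrix.transvection, Matrix.one_apply_ne h1, hij.symm]
      · rfl
    · simp

end
end

section
/- Let α = (α_1,…,α_n) ∈ ℕ^n be a tuple which is not decreasing, i.e. α_j < α_{j+1} for some j, and let R be a lattice in O^n belonging to S_α. Then there exists a map φ from K to the group of upper triangular unipotent n×n matrices over F such that: φ(s+t) = φ(s)·φ(t) for all s, t ∈ K; φ(t)·R = R for all t ∈ K; and Σ_{i=1}^{n−1} res(φ(t)_{i,i+1} dϖ) = t for all t ∈ K. -/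
open PowerSeries

noncomputable section

variable (K : Type*) [Field K]

open Matrix in
/-- The transvections `1 + c u wᵀ` with `w ⬝ᵥ u = 0` multiply by adding the parameters `c`. -/
theorem one_add_smul_vecMulVec_mul {A : Type*} [CommRing A] {ι : Type*} [Fintype ι] [DecidableEq ι]
    (u w : ι → A) (h : w ⬝ᵥ u = 0) (c d : A) :
    (1 + c • vecMulVec u w) * (1 + d • vecMulVec u w) = 1 + (c + d) • vecMulVec u w := by
  have h0 : vecMulVec u w * vecMulVec u w = 0 := by
    rw [vecMulVec_mul_vecMulVec, h, zero_smul]; simp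
  simp only [mul_add, add_mul, one_mul, mul_one, Algebra.mul_smul_comm, Algebra.smul_mul_assoc,
    h0, smul_zero, add_zero, add_smul]
  abel

/-- A lattice `R ∈ S_α` is spanned by any vectors `v i ∈ R ∩ coordsLE i` whose `i`-th coordinate
is `X ^ α i`. -/
theorem MemS.le_span {n : ℕ} {α : Fin n → ℕ}
    {R : Submodule (PowerSeries K) (Fin n → PowerSeries K)} (hS : MemS K α R)
    (v : Fin n → Fin n → PowerSeries K) (hvR : ∀ i, v i ∈ R)
    (hvT : ∀ i j, i < j → v i j = 0) (hvd : ∀ i, v i i = X ^ α i) :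
    R ≤ Submodule.span (PowerSeries K) (Set.range v) := by
  have key : ∀ k : ℕ, ∀ x ∈ R, (∀ j : Fin n, k ≤ j → x j = 0) →
      x ∈ Submodule.span (PowerSeries K) (Set.range v) := by
    intro k
    induction k with
    | zero =>
      intro x _ h
      have : x = 0 := funext fun j => h j (Nat.zero_le _)
      exact this ▸ zero_mem _
    | succ k ih =>
      intro x hx h
      by_cases hk : k < n
      · let i : Fin n := ⟨k, hk⟩
        have hxi : x i ∈ Submodule.span (PowerSeries K) {(X : PowerSeries K) ^ α i} := by
          rw [← hS i]
          exact ⟨x, ⟨hx, fun j hj => h j hj⟩, rfl⟩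
        obtain ⟨a, ha⟩ := Submodule.mem_span_singleton.1 hxi
        have := ih (x - a • v i) (R.sub_mem hx (R.smul_mem a (hvR i))) (by
          intro j hj
          rcases hj.eq_or_lt with hj | hj
          · obtain rfl : i = j := Fin.ext hj
            simp [hvd, ← ha]
          · simp [h j hj, hvT i j hj])
        rw [← sub_add_cancel x (a • v i)]
        exact add_mem this (Submodule.smul_mem _ _ (Submodule.subset_span ⟨i, rfl⟩))
      · exact ih x hx fun j hj => absurd (j.2.trans_le (not_lt.1 hk)) (not_lt.2 hj)
  exact fun x hx => key n x hx fun j hj => absurd j.2 (not_lt.2 hj)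

/-- A lattice in `S_α` contains vectors `v i ∈ coordsLE i` whose `i`-th coordinate is `X ^ α i`. -/
theorem MemS.exists_basis {n : ℕ} {α : Fin n → ℕ}
    {R : Submodule (PowerSeries K) (Fin n → PowerSeries K)} (hS : MemS K α R) :
    ∃ v : Fin n → Fin n → PowerSeries K, (∀ i, v i ∈ R) ∧
      (∀ i j, i < j → v i j = 0) ∧ ∀ i, v i i = X ^ α i := by
  have h : ∀ i, ∃ x ∈ R ⊓ coordsLE K i, x i = X ^ α i := fun i => by
    have : (X : PowerSeries K) ^ α i ∈ Submodule.map (LinearMap.proj i) (R ⊓ coordsLE K i) := by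
      rw [hS i]; exact Submodule.mem_span_singleton_self _
    exact this
  choose v hv hd using h
  exact ⟨v, fun i => (hv i).1, fun i j hij => (hv i).2 j hij, hd⟩

open Matrix in
/-- A lower triangular matrix with nonzero diagonal over a field has a left dual system of
vectors, whose `k`-th member is supported on the coordinates `≥ k`. -/
theorem exists_dual_of_triangular {F : Type*} [Field F] {n : ℕ} (v : Fin n → Fin n → F)
    (hT : ∀ i j, i < j → v i j = 0) (hd : ∀ i, v i i ≠ 0) (k : Fin n) :
    ∃ w : Fin n → F, (∀ i, w ⬝ᵥ v i = if i = k then 1 else 0) ∧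
      (∀ i, i < k → w i = 0) ∧ w k = (v k k)⁻¹ := by
  let B : Matrix (Fin n) (Fin n) F := (Matrix.of v)ᵀ
  have hB : B.BlockTriangular id := fun i j hij => hT j i hij
  have hdet : IsUnit B.det := by
    rw [det_of_isUpperTriangular hB]
    exact isUnit_iff_ne_zero.2 (Finset.prod_ne_zero_iff.2 fun i _ => hd i)
  have hinv : B⁻¹ * B = 1 := nonsing_inv_mul _ hdet
  have : Invertible B := invertibleOfIsUnitDet _ hdet
  have hC : B⁻¹.BlockTriangular id := blockTriangular_inv_of_blockTriangular hB
  have hw : ∀ i, B⁻¹ k ⬝ᵥ v i = if i = k then 1 else 0 := fun i => by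
    have h : B⁻¹ k ⬝ᵥ v i = _ := congrFun (congrFun hinv k) i
    rw [h, one_apply]
    simp only [eq_comm]
  refine ⟨B⁻¹ k, hw, fun i hi => hC hi, ?_⟩
  have h := hw k
  rw [if_pos rfl, dotProduct, Finset.sum_eq_single k] at h
  · exact eq_inv_of_mul_eq_one_left h
  · intro i _ hik
    rcases lt_or_gt_of_ne hik with h' | h'
    · rw [hC h', zero_mul]
    · rw [hT k i h', mul_zero]
  · simp

open Matrix in
/-- If `α` is not decreasing and `R ∈ S_α` is a lattice, there is a map
`φ : K → N(F)` with `φ(s+t) = φ(s)·φ(t)`, `φ(t)·R = R` and `Σ res(φ(t)_{i,i+1} dϖ) = t`. -/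
theorem stmt12 {n : ℕ} (α : Fin n → ℕ)
    (hα : ∃ j : Fin n, ∃ h : (j : ℕ) + 1 < n, α j < α ⟨(j : ℕ) + 1, h⟩)
    (R : Submodule (PowerSeries K) (Fin n → PowerSeries K))
    (hR : IsLattice K R) (hS : MemS K α R) :
    ∃ φ : K → Matrix (Fin n) (Fin n) (LaurentSeries K),
      (∀ t, UnipUpper (φ t)) ∧
      (∀ s t, φ (s + t) = φ s * φ t) ∧
      (∀ t, Submodule.map
          (LinearMap.restrictScalars (PowerSeries K) (Matrix.mulVecLin (φ t)))
          (Submodule.map (toLaurent K n) R) = Submodule.map (toLaurent K n) R) ∧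
      (∀ t, resSum K (φ t) = t) := by
  obtain ⟨j, hj, hlt⟩ := hα
  set k : Fin n := ⟨(j : ℕ) + 1, hj⟩ with hk
  obtain ⟨m, hm⟩ := Nat.exists_eq_add_of_lt hlt
  obtain ⟨v, hvR, hvT, hvd⟩ := hS.exists_basis
  let ι := algebraMap (PowerSeries K) (LaurentSeries K)
  have hinj : Function.Injective ι := FaithfulSMul.algebraMap_injective _ _
  have hjk : j < k := Fin.lt_def.2 (Nat.lt_succ_self _)
  obtain ⟨w, hw, hwT, hwk⟩ := exists_dual_of_triangular (fun i => toLaurent K n (v i))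
    (fun i l h => (congrArg ι (hvT i l h)).trans (map_zero ι))
    (fun i => (map_ne_zero_iff ι hinj).2 (ne_of_eq_of_ne (hvd i) (pow_ne_zero _ X_ne_zero))) k
  let u := toLaurent K n (v j)
  have hu : ∀ i, j < i → u i = 0 := fun i h => (congrArg ι (hvT j i h)).trans (map_zero ι)
  let c : K → PowerSeries K := fun t => C t * X ^ m
  have hc : ∀ s t, c (s + t) = c s + c t := fun s t => by simp [c, add_mul]
  let φ : K → Matrix (Fin n) (Fin n) (LaurentSeries K) := fun t => 1 + ι (c t) • vecMulVec u w
  have happ : ∀ t i l, φ t i l = (1 : Matrix (Fin n) (Fin n) (LaurentSeries K)) i l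
      + ι (c t) * (u i * w l) := fun t i l => rfl
  have hadd : ∀ s t, φ (s + t) = φ s * φ t := fun s t => by
    simp only [φ]
    rw [one_add_smul_vecMulVec_mul u w (by rw [hw, if_neg hjk.ne]), hc, map_add]
  have hφ0 : φ 0 = 1 := by simp [φ, c]
  have hle : ∀ t, Submodule.map
      (LinearMap.restrictScalars (PowerSeries K) (Matrix.mulVecLin (φ t)))
      (Submodule.map (toLaurent K n) R) ≤ Submodule.map (toLaurent K n) R := fun t => by
    rw [← Submodule.map_comp, Submodule.map_le_iff_le_comap]
    refine (hS.le_span K v hvR hvT hvd).trans (Submodule.span_le.2 ?_)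
    rintro _ ⟨i, rfl⟩
    refine ⟨v i + (if i = k then c t else 0) • v j,
      R.add_mem (hvR i) (R.smul_mem _ (hvR j)), ?_⟩
    have : φ t *ᵥ toLaurent K n (v i) = toLaurent K n (v i)
        + (ι (c t) * if i = k then 1 else 0) • u := by
      simp only [φ]
      rw [add_mulVec, one_mulVec, smul_mulVec, vecMulVec_mulVec, hw]
      ext1 l
      simp [mul_comm]
    rw [map_add, map_smul]
    refine Eq.trans ?_ this.symm
    congr 1
    split_ifs
    · rw [mul_one]; exact (algebraMap_smul _ _ _).symm
    · simp
  refine ⟨φ, fun t => ⟨fun i => ?_, fun i l h => ?_⟩, hadd, fun t => (hle t).antisymm ?_,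
    fun t => ?_⟩
  · rw [happ, one_apply_eq]
    rcases lt_or_ge j i with h | h
    · simp [hu i h]
    · simp [hwT i (h.trans_lt hjk)]
  · rw [happ, one_apply_ne h.ne']
    rcases lt_or_ge j i with h' | h'
    · simp [hu i h']
    · simp [hwT l ((h.trans_le h').trans hjk)]
  · intro x hx
    refine ⟨φ (-t) *ᵥ x, hle (-t) ⟨x, hx, rfl⟩, ?_⟩
    change φ t *ᵥ (φ (-t) *ᵥ x) = x
    rw [mulVec_mulVec, ← hadd, add_neg_cancel, hφ0, one_mulVec]
  · have hjj : ι (c t) * (u j * w k) = HahnSeries.single (-1) t := by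
      have h1 : u j = ι (X ^ α j) := congrArg ι (hvd j)
      have h2 : w k = (ι (X ^ α k))⁻¹ := hwk.trans (congrArg (fun y => (ι y)⁻¹) (hvd k))
      have h3 : ι (X ^ α k) ≠ 0 := (map_ne_zero_iff ι hinj).2 (pow_ne_zero _ X_ne_zero)
      have hC : ι (C t) = HahnSeries.single 0 t := HahnSeries.ofPowerSeries_C t
      have hX : ∀ q : ℕ, ι (X ^ q) = HahnSeries.single (q : ℤ) 1 :=
        fun q => HahnSeries.ofPowerSeries_X_pow q
      rw [h1, h2, ← mul_assoc, ← div_eq_mul_inv, div_eq_iff h3]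
      simp only [c, map_mul, hC, hX, HahnSeries.single_mul_single, mul_one, hm]
      congr 2
      push_cast
      ring
    rw [resSum, Finset.sum_eq_single j]
    · rw [dif_pos hj, happ, ← hk, one_apply_ne hjk.ne, zero_add, hjj, HahnSeries.coeff_single_same]
    · intro i _ hij
      split_ifs with h
      · rw [happ, one_apply_ne (Fin.ne_of_lt (Fin.lt_def.2 (Nat.lt_succ_self _)))]
        rcases lt_or_gt_of_ne hij with h' | h'
        · rw [hwT _ (Fin.lt_def.2 (Nat.succ_lt_succ h'))]; simp
        · rw [hu i h']; simp
      · rfl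
    · simp

end
end

section
/- For every O-submodule R ⊆ O^n with dim_K(O^n/R) = d finite, there exists a unique tuple α = (α_1,…,α_n) ∈ ℕ^n such that R belongs to S_α; moreover this α satisfies α_1 + ⋯ + α_n = d. -/
open PowerSeries

noncomputable section

variable (K : Type*) [Field K]

/-- The truncated vectors `∑ c i m • X ^ m • e i` with `m < α i`. -/
def truncVec {n : ℕ} (α : Fin n → ℕ) :
    (∀ i, Fin (α i) → K) →ₗ[K] (Fin n → PowerSeries K) where
  toFun c i := PowerSeries.mk fun m => if h : m < α i then c i ⟨m, h⟩ else 0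
  map_add' a b := by
    ext i m
    by_cases h : m < α i <;> simp [h]
  map_smul' r a := by
    ext i m
    by_cases h : m < α i <;> simp [h]

variable {K}

lemma coeff_truncVec {n : ℕ} (α : Fin n → ℕ) (c : ∀ i, Fin (α i) → K) (i : Fin n) (m : ℕ) :
    coeff m (truncVec K α c i) = if h : m < α i then c i ⟨m, h⟩ else 0 := by
  simp [truncVec]

lemma MemS.unique {n : ℕ} {α β : Fin n → ℕ}
    {R : Submodule (PowerSeries K) (Fin n → PowerSeries K)}
    (hα : MemS K α R) (hβ : MemS K β R) : α = β := by
  funext i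
  have h : Ideal.span {(X : PowerSeries K) ^ α i} = Ideal.span {X ^ β i} :=
    (hα i).symm.trans (hβ i)
  have h₁ := Ideal.span_singleton_le_span_singleton.mp h.le
  have h₂ := Ideal.span_singleton_le_span_singleton.mp h.ge
  rw [pow_dvd_pow_iff X_ne_zero X_prime.not_isUnit] at h₁ h₂
  exact le_antisymm h₂ h₁

lemma exists_memS {n : ℕ} (R : Submodule (PowerSeries K) (Fin n → PowerSeries K))
    (hfin : IsLattice K R) : ∃ α, MemS K α R := by
  suffices h : ∀ i : Fin n, ∃ a : ℕ,
      Submodule.map (LinearMap.proj i) (R ⊓ coordsLE K i)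
        = Submodule.span (PowerSeries K) {(X : PowerSeries K) ^ a} by
    choose α hα using h
    exact ⟨α, hα⟩
  intro i
  refine IsDiscreteValuationRing.ideal_eq_span_pow_irreducible
    (s := Submodule.map (LinearMap.proj i) (R ⊓ coordsLE K i)) ?_ X_prime.irreducible
  intro hbot
  have hfin : FiniteDimensional K ((Fin n → PowerSeries K) ⧸ R.restrictScalars K) := hfin
  let f : PowerSeries K →ₗ[K] (Fin n → PowerSeries K) ⧸ R.restrictScalars K :=
    (R.restrictScalars K).mkQ ∘ₗ LinearMap.single K (fun _ : Fin n => PowerSeries K) i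
  have hf : Function.Injective f := by
    refine (injective_iff_map_eq_zero f).mpr fun g hg => ?_
    have hR : Pi.single i g ∈ R := by simpa [f] using hg
    have hmem : g ∈ Submodule.map (LinearMap.proj i) (R ⊓ coordsLE K i) :=
      ⟨Pi.single i g, ⟨hR, fun j hj => by simp [hj.ne']⟩, by simp⟩
    rw [hbot] at hmem
    exact hmem
  have : FiniteDimensional K (PowerSeries K) := FiniteDimensional.of_injective f hf
  have : FiniteDimensional K (Polynomial K) :=
    FiniteDimensional.of_injective (Polynomial.coeToPowerSeries.algHom K).toLinearMap
      fun p q h => Polynomial.coe_injective K (by simpa using h)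
  exact Polynomial.not_finite this

lemma MemS.truncVec_eq_zero {n : ℕ} {α : Fin n → ℕ}
    {R : Submodule (PowerSeries K) (Fin n → PowerSeries K)} (hα : MemS K α R)
    {c : ∀ i, Fin (α i) → K} (hc : truncVec K α c ∈ R) : c = 0 := by
  have key : ∀ i, truncVec K α c i = 0 := by
    intro i
    induction i using WellFoundedGT.induction with
    | ind i ih =>
      have hmem : truncVec K α c i ∈ Ideal.span {(X : PowerSeries K) ^ α i} :=
        (hα i).le ⟨_, ⟨hc, ih⟩, rfl⟩
      have hdvd := X_pow_dvd_iff.mp (Ideal.mem_span_singleton.mp hmem)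
      ext m
      by_cases h : m < α i
      · simpa using hdvd m h
      · simp [coeff_truncVec, h]
  funext i m
  simpa [key] using (coeff_truncVec α c i m).symm

lemma MemS.exists_sub_truncVec_mem {n : ℕ} {α : Fin n → ℕ}
    {R : Submodule (PowerSeries K) (Fin n → PowerSeries K)} (hα : MemS K α R)
    (v : Fin n → PowerSeries K) : ∃ c, v - truncVec K α c ∈ R := by
  suffices h : ∀ (k : ℕ) (v : Fin n → PowerSeries K), (∀ j : Fin n, k ≤ j → v j = 0) →
      ∃ c, v - truncVec K α c ∈ R from
    h n v fun j hj => absurd j.isLt hj.not_gt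
  intro k
  induction k with
  | zero =>
    intro v hv
    have hv : v = 0 := funext fun j => hv j (Nat.zero_le _)
    exact ⟨0, by simp [hv]⟩
  | succ k ih =>
    intro v hv
    by_cases hk : k < n
    swap
    · exact ih v fun j hj => absurd (hj.trans_lt j.isLt) hk
    let i : Fin n := ⟨k, hk⟩
    let c : ∀ i, Fin (α i) → K := Pi.single i fun m => coeff m (v i)
    have hci : v i - truncVec K α c i ∈ Submodule.span (PowerSeries K) {X ^ α i} := by
      refine Ideal.mem_span_singleton.mpr (X_pow_dvd_iff.mpr fun m hm => ?_)
      simp [coeff_truncVec, hm, c]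
    have hcj : ∀ j, j ≠ i → truncVec K α c j = 0 := by
      intro j hj
      ext m
      simp [coeff_truncVec, c, Pi.single_eq_of_ne hj]
    rw [← hα i] at hci
    obtain ⟨r, ⟨hrR, hr⟩, hri⟩ := hci
    replace hri : r i = v i - truncVec K α c i := hri
    obtain ⟨c', hc'⟩ := ih (v - truncVec K α c - r) fun j hj => by
      rcases hj.eq_or_lt with h | h
      · obtain rfl : i = j := Fin.ext h
        simp [hri]
      · have hij : i < j := h
        simp [hv j h, hcj j hij.ne', hr j hij]
    refine ⟨c + c', ?_⟩
    have := R.add_mem hc' hrR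
    rw [map_add]
    convert this using 1
    abel

lemma MemS.finrank_quotient {n : ℕ} {α : Fin n → ℕ}
    {R : Submodule (PowerSeries K) (Fin n → PowerSeries K)} (hα : MemS K α R) :
    Module.finrank K ((Fin n → PowerSeries K) ⧸ R.restrictScalars K) = ∑ i, α i := by
  have hbij : Function.Bijective ((R.restrictScalars K).mkQ ∘ₗ truncVec K α) := by
    constructor
    · refine (injective_iff_map_eq_zero _).mpr fun c hc => hα.truncVec_eq_zero ?_
      simpa using hc
    · intro q
      obtain ⟨v, rfl⟩ := Submodule.mkQ_surjective _ q
      obtain ⟨c, hc⟩ := hα.exists_sub_truncVec_mem v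
      exact ⟨c, ((Submodule.Quotient.eq (R.restrictScalars K)).mpr hc).symm⟩
  rw [← (LinearEquiv.ofBijective _ hbij).finrank_eq, Module.finrank_pi_fintype]
  simp

variable (K)

/-- Every `O`-submodule `R ⊆ O^n` with `dim_K(O^n/R) = d` finite belongs to
`S_α` for exactly one `α ∈ ℕ^n`, and this `α` satisfies `α_1 + ⋯ + α_n = d`. -/
theorem stmt13 {n d : ℕ} (R : Submodule (PowerSeries K) (Fin n → PowerSeries K))
    (hfin : FiniteDimensional K ((Fin n → PowerSeries K) ⧸ R.restrictScalars K))
    (hd : Module.finrank K ((Fin n → PowerSeries K) ⧸ R.restrictScalars K) = d) :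
    (∃! α : Fin n → ℕ, MemS K α R) ∧
    ∀ α : Fin n → ℕ, MemS K α R → ∑ i, α i = d := by
  obtain ⟨α, hα⟩ := exists_memS R hfin
  exact ⟨⟨α, hα, fun β hβ => hβ.unique hα⟩, fun β hβ => hβ.finrank_quotient.symm.trans hd⟩

end
end

section
/- Let λ = (λ_1 ≥ ⋯ ≥ λ_n ≥ 0) with λ_1+⋯+λ_n = d, and let τ: {1,…,d} → {1,…,n} be a function such that |τ^{−1}(j)| = λ_j for every j. For 0 ≤ i ≤ d define α^i ∈ ℕ^n by α^i_j = |τ^{−1}(j) ∩ {1,…,i}|. Then the set of flags of lattices O^n = R_0 ⊃ R_1 ⊃ ⋯ ⊃ R_d such that dim_K(R_{i−1}/R_i) = 1 and R_i belongs to S_{α^i} for every i, is in bijection with the affine space K^N where N = Σ_{i=1}^d (n − τ(i)) = Σ_{j=1}^n λ_j(n−j). -/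
open PowerSeries

noncomputable section

variable (K : Type*) [Field K]

/-- A complete flag of lattices `O^n = R_0 ⊃ R_1 ⊃ ⋯ ⊃ R_d` with one-dimensional
successive quotients (over `K`). -/
def IsFlag {n d : ℕ}
    (R : Fin (d + 1) → Submodule (PowerSeries K) (Fin n → PowerSeries K)) : Prop :=
  R 0 = ⊤ ∧
  ∀ i : Fin d,
    R i.succ ≤ R i.castSucc ∧
    Module.finrank K
      ((R i.castSucc) ⧸
        Submodule.restrictScalars K ((R i.succ).comap (R i.castSucc).subtype)) = 1

section FlagSteps

variable {K} {n : ℕ}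

/-- A basis of `R` adapted to the coordinate filtration of `O^n`, with diagonal `X ^ α i`. -/
def IsTriangular {R : Submodule (PowerSeries K) (Fin n → PowerSeries K)} (α : Fin n → ℕ)
    (b : Module.Basis (Fin n) (PowerSeries K) R) : Prop :=
  ∀ i, (b i : Fin n → PowerSeries K) ∈ coordsLE K i ∧
    (b i : Fin n → PowerSeries K) i = X ^ α i

theorem eq_zero_of_triangular {v : Fin n → Fin n → PowerSeries K} {α : Fin n → ℕ}
    (hv : ∀ i, v i ∈ coordsLE K i) (hd : ∀ i, v i i = X ^ α i)
    {S : Set (Fin n)} (hS : IsUpperSet S) (a : Fin n → PowerSeries K)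
    (h : ∀ i ∈ S, (∑ k, a k • v k) i = 0) : ∀ i ∈ S, a i = 0 := by
  by_contra! hne
  obtain ⟨i₀, hi₀, hai₀⟩ := hne
  obtain ⟨i, hi, hmax⟩ := (Set.toFinite {i | i ∈ S ∧ a i ≠ 0}).exists_maximal ⟨i₀, hi₀, hai₀⟩
  have h1 := h i hi.1
  rw [Finset.sum_apply, Finset.sum_eq_single i] at h1
  · rw [Pi.smul_apply, hd, smul_eq_mul] at h1
    exact hi.2 ((mul_eq_zero.1 h1).resolve_right (pow_ne_zero _ X_ne_zero))
  · intro k _ hk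
    rcases lt_or_gt_of_ne hk with hlt | hgt
    · simp [hv k i hlt]
    · have : a k = 0 := by
        by_contra hak
        exact absurd (hmax ⟨hS hgt.le hi.1, hak⟩ hgt.le) (not_le.2 hgt)
      simp [this]
  · simp

theorem mem_span_of_triangular {R : Submodule (PowerSeries K) (Fin n → PowerSeries K)}
    {α : Fin n → ℕ} (hR : MemS K α R) {v : Fin n → Fin n → PowerSeries K}
    (hvR : ∀ i, v i ∈ R) (hv : ∀ i, v i ∈ coordsLE K i) (hd : ∀ i, v i i = X ^ α i) (m : ℕ) :
    ∀ w ∈ R, (∀ i : Fin n, m ≤ i → w i = 0) → w ∈ Submodule.span (PowerSeries K) (Set.range v) := by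
  induction m with
  | zero =>
    intro w _ h
    have : w = 0 := funext fun i => h i (Nat.zero_le _)
    simp [this]
  | succ m ih =>
    intro w hw h
    by_cases hm : m < n
    · have hmem : w ⟨m, hm⟩ ∈ Submodule.span (PowerSeries K) {(X : PowerSeries K) ^ α ⟨m, hm⟩} := by
        rw [← hR ⟨m, hm⟩]
        exact ⟨w, ⟨hw, fun j hj => h j hj⟩, rfl⟩
      obtain ⟨a, ha⟩ := Submodule.mem_span_singleton.1 hmem
      have h1 := ih (w - a • v ⟨m, hm⟩) (R.sub_mem hw (R.smul_mem _ (hvR _))) (by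
        intro i hi
        rcases hi.eq_or_lt with rfl | hlt
        · simp [hd, ← ha]
        · simp [h i hlt, hv ⟨m, hm⟩ i hlt])
      have h2 := Submodule.add_mem _ h1
        (Submodule.smul_mem _ a (Submodule.subset_span (Set.mem_range_self ⟨m, hm⟩)))
      simpa using h2
    · exact ih w hw fun i hi => absurd (i.2.trans_le (not_lt.1 hm)) (not_lt.2 hi)

theorem exists_triangular_basis {R : Submodule (PowerSeries K) (Fin n → PowerSeries K)}
    {α : Fin n → ℕ} (hR : MemS K α R) :
    ∃ b : Module.Basis (Fin n) (PowerSeries K) R, IsTriangular α b := by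
  have hex : ∀ i, ∃ v, v ∈ R ∧ v ∈ coordsLE K i ∧ v i = X ^ α i := by
    intro i
    have : (X : PowerSeries K) ^ α i ∈ Submodule.map (LinearMap.proj i) (R ⊓ coordsLE K i) := by
      rw [hR i]; exact Submodule.mem_span_singleton_self _
    obtain ⟨v, ⟨h1, h2⟩, h3⟩ := this
    exact ⟨v, h1, h2, h3⟩
  choose v hvR hv hd using hex
  have hli : LinearIndependent (PowerSeries K) v := by
    rw [Fintype.linearIndependent_iff]
    intro a ha i
    exact eq_zero_of_triangular hv hd isUpperSet_univ a (fun i _ => by rw [ha]; rfl) i trivial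
  have hspan : Submodule.span (PowerSeries K) (Set.range v) = R := by
    refine le_antisymm (Submodule.span_le.2 ?_) fun w hw =>
      mem_span_of_triangular hR hvR hv hd n w hw fun i hi => absurd i.2 (not_lt.2 hi)
    rintro _ ⟨i, rfl⟩
    exact hvR i
  refine ⟨(Module.Basis.span hli).map (LinearEquiv.ofEq _ _ hspan), fun i => ?_⟩
  simp [Module.Basis.span_apply, hv, hd]

theorem IsTriangular.repr_eq_zero {R : Submodule (PowerSeries K) (Fin n → PowerSeries K)}
    {α : Fin n → ℕ} {b : Module.Basis (Fin n) (PowerSeries K) R} (hb : IsTriangular α b)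
    {w : R} {j : Fin n} (hw : (w : Fin n → PowerSeries K) ∈ coordsLE K j) {i : Fin n}
    (hi : j < i) : b.repr w i = 0 := by
  refine eq_zero_of_triangular (fun i => (hb i).1) (fun i => (hb i).2) (isUpperSet_Ioi j)
    (fun i => b.repr w i) (fun i hi => ?_) i hi
  have h := congrArg (Subtype.val) (b.sum_repr w)
  simp only [AddSubmonoidClass.coe_finsetSum, Submodule.coe_smul] at h
  rw [h]
  exact hw i hi

/-- The sublattice of `R` on which the linear form with values `C (c i)` on the basis `b`
has vanishing constant coefficient. -/
def hyperplane {R : Submodule (PowerSeries K) (Fin n → PowerSeries K)}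
    (b : Module.Basis (Fin n) (PowerSeries K) R) (c : Fin n → K) :
    Submodule (PowerSeries K) (Fin n → PowerSeries K) :=
  (Submodule.comap (b.constr ℕ fun i => (C (c i) : PowerSeries K))
    (RingHom.ker (constantCoeff (R := K)))).map R.subtype

theorem mem_hyperplane {R : Submodule (PowerSeries K) (Fin n → PowerSeries K)}
    (b : Module.Basis (Fin n) (PowerSeries K) R) (c : Fin n → K) (w : R) :
    (w : Fin n → PowerSeries K) ∈ hyperplane b c ↔
      ∑ i, constantCoeff (b.repr w i) * c i = 0 := by
  simp [hyperplane, Module.Basis.constr_apply_fintype, RingHom.mem_ker]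

theorem sum_constantCoeff_single (i : Fin n) (f : PowerSeries K) (c : Fin n → K) :
    ∑ k, constantCoeff (Finsupp.single i f k) * c k = constantCoeff f * c i := by
  rw [Finset.sum_eq_single i]
  · simp
  · intro k _ hk
    simp [Finsupp.single_eq_of_ne hk]
  · simp

theorem hyperplane_le {R : Submodule (PowerSeries K) (Fin n → PowerSeries K)}
    (b : Module.Basis (Fin n) (PowerSeries K) R) (c : Fin n → K) : hyperplane b c ≤ R :=
  Submodule.map_subtype_le _ _

/-- The linear form on `R` over `K` with kernel `hyperplane b c`. -/
def hyperplaneForm {R : Submodule (PowerSeries K) (Fin n → PowerSeries K)}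
    (b : Module.Basis (Fin n) (PowerSeries K) R) (c : Fin n → K) : R →ₗ[K] K :=
  (coeff (R := K) 0).comp
    ((b.constr ℕ fun i => (C (c i) : PowerSeries K)).restrictScalars K)

theorem hyperplaneForm_apply {R : Submodule (PowerSeries K) (Fin n → PowerSeries K)}
    (b : Module.Basis (Fin n) (PowerSeries K) R) (c : Fin n → K) (w : R) :
    hyperplaneForm b c w = ∑ i, constantCoeff (b.repr w i) * c i := by
  simp [hyperplaneForm, Module.Basis.constr_apply_fintype]

theorem finrank_quotient_hyperplane {R : Submodule (PowerSeries K) (Fin n → PowerSeries K)}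
    (b : Module.Basis (Fin n) (PowerSeries K) R) {c : Fin n → K} {j : Fin n} (hc : c j = 1) :
    Module.finrank K
      (R ⧸ Submodule.restrictScalars K ((hyperplane b c).comap R.subtype)) = 1 := by
  have hker : Submodule.restrictScalars K ((hyperplane b c).comap R.subtype) =
      LinearMap.ker (hyperplaneForm b c) := by
    ext w
    rw [LinearMap.mem_ker, hyperplaneForm_apply, ← mem_hyperplane]
    rfl
  have hne : hyperplaneForm b c ≠ 0 := by
    intro h
    have h1 : hyperplaneForm b c (b j) = 0 := by rw [h]; rfl
    rw [hyperplaneForm_apply, b.repr_self, sum_constantCoeff_single] at h1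
    simp [hc] at h1
  rw [hker, LinearEquiv.finrank_eq
    ((hyperplaneForm b c).quotKerEquivOfSurjective (LinearMap.surjective hne))]
  exact Module.finrank_self K

theorem sub_smul_mem_hyperplane {R : Submodule (PowerSeries K) (Fin n → PowerSeries K)}
    (b : Module.Basis (Fin n) (PowerSeries K) R) {c : Fin n → K} {j : Fin n} (hc : c j = 1)
    (i : Fin n) (a : K) :
    (b i : Fin n → PowerSeries K) - (C a : PowerSeries K) • (b j : Fin n → PowerSeries K)
      ∈ hyperplane b c ↔ a = c i := by
  have h := mem_hyperplane b c (b i - (C a : PowerSeries K) • b j)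
  rw [Submodule.coe_sub, Submodule.coe_smul] at h
  rw [h]
  simp only [map_sub, map_smul, b.repr_self, Finsupp.smul_single, Finsupp.sub_apply, sub_mul,
    Finset.sum_sub_distrib, sum_constantCoeff_single]
  simp [hc, sub_eq_zero, eq_comm]

theorem memS_hyperplane {R : Submodule (PowerSeries K) (Fin n → PowerSeries K)}
    {α : Fin n → ℕ} (hR : MemS K α R) {b : Module.Basis (Fin n) (PowerSeries K) R}
    (hb : IsTriangular α b) {c : Fin n → K} {j : Fin n} (hc : c j = 1)
    (hlt : ∀ i < j, c i = 0) :
    MemS K (fun i => α i + if i = j then 1 else 0) (hyperplane b c) := by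
  intro i
  apply le_antisymm
  · rintro _ ⟨w, ⟨hw, hwi⟩, rfl⟩
    by_cases hij : i = j
    · subst hij
      lift w to R using hyperplane_le b c hw
      have hz := fun k (hk : i < k) => hb.repr_eq_zero hwi hk
      have hw0 := (mem_hyperplane b c w).1 hw
      rw [Finset.sum_eq_single i] at hw0
      · rw [hc, mul_one, ← X_dvd_iff] at hw0
        obtain ⟨q, hq⟩ := hw0
        have h := congrFun (congrArg (Subtype.val) (b.sum_repr w)) i
        simp only [AddSubmonoidClass.coe_finsetSum, Submodule.coe_smul, Finset.sum_apply,
          Pi.smul_apply] at h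
        rw [Finset.sum_eq_single i] at h
        · rw [LinearMap.proj_apply, ← h, (hb i).2, hq]
          refine Submodule.mem_span_singleton.2 ⟨q, ?_⟩
          simp [pow_succ]
          ring
        · intro k _ hk
          rcases lt_or_gt_of_ne hk with h1 | h1
          · simp [(hb k).1 i h1]
          · simp [hz k h1]
        · simp
      · intro k _ hk
        rcases lt_or_gt_of_ne hk with h1 | h1
        · simp [hlt k h1]
        · simp [hz k h1]
      · simp
    · simp only [hij, if_false, add_zero]
      rw [← hR i]
      exact ⟨w, ⟨hyperplane_le b c hw, hwi⟩, rfl⟩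
  · rw [Submodule.span_singleton_le_iff_mem]
    by_cases hij : i = j
    · subst hij
      refine ⟨((X : PowerSeries K) • b i : R), ⟨(mem_hyperplane b c _).2 ?_, ?_⟩, ?_⟩
      · simp only [map_smul, b.repr_self, Finsupp.smul_single, sum_constantCoeff_single]
        simp
      · exact Submodule.smul_mem _ _ (hb i).1
      · simp [(hb i).2, pow_succ, mul_comm]
    · refine ⟨_, ⟨(sub_smul_mem_hyperplane b hc i (c i)).2 rfl, ?_⟩, ?_⟩
      · refine Submodule.sub_mem _ (hb i).1 ?_
        rcases lt_or_gt_of_ne hij with h | h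
        · simp [hlt i h]
        · exact Submodule.smul_mem _ _ fun k hk => (hb j).1 k (h.trans hk)
      · rcases lt_or_gt_of_ne hij with h | h
        · simp [hlt i h, (hb i).2, hij]
        · simp [(hb j).1 i h, (hb i).2, hij]

/-- `R'` is contained in `R` with one-dimensional quotient. -/
def IsStep (R R' : Submodule (PowerSeries K) (Fin n → PowerSeries K)) : Prop :=
  R' ≤ R ∧ Module.finrank K (R ⧸ Submodule.restrictScalars K (R'.comap R.subtype)) = 1

section Step

variable {R R' : Submodule (PowerSeries K) (Fin n → PowerSeries K)}

theorem IsStep.exists_sub_smul_mem (h : IsStep R R') {v w : Fin n → PowerSeries K}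
    (hv : v ∈ R) (hv' : v ∉ R') (hw : w ∈ R) :
    ∃ a : K, w - (C a : PowerSeries K) • v ∈ R' := by
  let N := Submodule.restrictScalars K (R'.comap R.subtype)
  have hne : N.mkQ ⟨v, hv⟩ ≠ 0 := by
    rw [Submodule.mkQ_apply, Ne, Submodule.Quotient.mk_eq_zero]
    exact hv'
  obtain ⟨a, ha⟩ := (finrank_eq_one_iff_of_nonzero' _ hne).1 h.2 (N.mkQ ⟨w, hw⟩)
  refine ⟨a, ?_⟩
  rw [← map_smul, Submodule.mkQ_apply, Submodule.mkQ_apply, eq_comm,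
    Submodule.Quotient.eq] at ha
  have h1 : w - a • v ∈ R' := ha
  convert h1 using 2
  ext k : 1
  simp [smul_eq_C_mul]

theorem IsStep.X_smul_mem (h : IsStep R R') {u : Fin n → PowerSeries K} (hu : u ∈ R) :
    (X : PowerSeries K) • u ∈ R' := by
  by_contra hX
  obtain ⟨a, ha⟩ := h.exists_sub_smul_mem (R.smul_mem X hu) hX hu
  have hunit : IsUnit (1 - C a * X : PowerSeries K) := by
    rw [isUnit_iff_constantCoeff]; simp
  have h1 : (1 - C a * X : PowerSeries K) • u ∈ R' := by
    rwa [sub_smul, one_smul, mul_smul]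
  exact hX (R'.smul_mem X ((Submodule.smul_mem_iff_of_isUnit _ hunit).1 h1))

theorem IsStep.smul_sub_mem (h : IsStep R R') {u : Fin n → PowerSeries K} (hu : u ∈ R)
    (f : PowerSeries K) : f • u - (C (constantCoeff f) : PowerSeries K) • u ∈ R' := by
  have hX : X ∣ f - C (constantCoeff f) := by rw [X_dvd_iff]; simp
  obtain ⟨q, hq⟩ := hX
  rw [← sub_smul, hq, mul_comm, mul_smul]
  exact R'.smul_mem q (h.X_smul_mem hu)

theorem IsStep.eq_hyperplane (h : IsStep R R') (b : Module.Basis (Fin n) (PowerSeries K) R)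
    {j : Fin n} (hj : (b j : Fin n → PowerSeries K) ∉ R') {c : Fin n → K}
    (hc : ∀ i, (b i : Fin n → PowerSeries K) - (C (c i) : PowerSeries K) •
      (b j : Fin n → PowerSeries K) ∈ R') : hyperplane b c = R' := by
  have key : ∀ w : R, (w : Fin n → PowerSeries K) -
      (C (∑ i, constantCoeff (b.repr w i) * c i) : PowerSeries K) •
        (b j : Fin n → PowerSeries K) ∈ R' := by
    intro w
    have hw := congrArg (Subtype.val) (b.sum_repr w)
    simp only [AddSubmonoidClass.coe_finsetSum, Submodule.coe_smul] at hw
    rw [← hw, map_sum, Finset.sum_smul, ← Finset.sum_sub_distrib]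
    refine R'.sum_mem fun i _ => ?_
    have h1 := h.smul_sub_mem (b i).2 (b.repr w i)
    have h2 := R'.smul_mem (C (constantCoeff (b.repr w i))) (hc i)
    convert R'.add_mem h1 h2 using 1
    rw [smul_sub, smul_smul, map_mul]
    abel
  have hsmul : ∀ a : K, (C a : PowerSeries K) • (b j : Fin n → PowerSeries K) ∈ R' → a = 0 := by
    intro a ha
    by_contra hne
    refine hj ((Submodule.smul_mem_iff_of_isUnit _ ?_).1 ha)
    exact (isUnit_iff_ne_zero.2 hne).map C
  ext w
  constructor
  · intro hw
    lift w to R using hyperplane_le b c hw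
    have h1 := key w
    rw [(mem_hyperplane b c w).1 hw] at h1
    simpa using h1
  · intro hw
    lift w to R using h.1 hw
    refine (mem_hyperplane b c w).2 (hsmul _ ?_)
    simpa using R'.sub_mem hw (key w)

theorem IsStep.isLattice (h : IsStep R R') (hR : IsLattice K R) : IsLattice K R' := by
  have h1 : R'.restrictScalars K ≤ R.restrictScalars K := h.1
  let N : Submodule K ((Fin n → PowerSeries K) ⧸ R'.restrictScalars K) :=
    (R.restrictScalars K).map (R'.restrictScalars K).mkQ
  have : FiniteDimensional K ((Fin n → PowerSeries K) ⧸ R.restrictScalars K) := hR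
  have : FiniteDimensional K (((Fin n → PowerSeries K) ⧸ R'.restrictScalars K) ⧸ N) :=
    Module.Finite.equiv (Submodule.quotientQuotientEquivQuotient _ _ h1).symm
  have : FiniteDimensional K (R ⧸ Submodule.restrictScalars K (R'.comap R.subtype)) :=
    FiniteDimensional.of_finrank_eq_succ h.2
  have : FiniteDimensional K N := by
    let f : R ⧸ Submodule.restrictScalars K (R'.comap R.subtype) →ₗ[K]
        (Fin n → PowerSeries K) ⧸ R'.restrictScalars K :=
      Submodule.mapQ _ _ (R.subtype.restrictScalars K) le_rfl
    have hf : LinearMap.range f = N := by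
      rw [← Submodule.map_top, ← Submodule.range_mkQ
        (Submodule.restrictScalars K (R'.comap R.subtype)), ← LinearMap.range_comp,
        show f ∘ₗ Submodule.mkQ _ = _ from Submodule.mapQ_mkQ _ _ _, LinearMap.range_comp]
      congr 1
      ext w
      simp
    rw [← hf]
    infer_instance
  exact Module.Finite.of_submodule_quotient N

end Step

/-- Extend coefficients on indices above `j` by `1` at `j` and `0` below. -/
def extendCoeff {j : Fin n} (c : {i // j < i} → K) (i : Fin n) : K :=
  if h : j < i then c ⟨i, h⟩ else if i = j then 1 else 0

theorem extendCoeff_self {j : Fin n} (c : {i // j < i} → K) : extendCoeff c j = 1 := by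
  simp [extendCoeff]

theorem extendCoeff_of_lt {j : Fin n} (c : {i // j < i} → K) {i : Fin n} (hi : i < j) :
    extendCoeff c i = 0 := by
  simp [extendCoeff, hi.not_gt, hi.ne]

theorem nonempty_step_equiv {R : Submodule (PowerSeries K) (Fin n → PowerSeries K)}
    {α : Fin n → ℕ} (hR : MemS K α R) (j : Fin n) :
    Nonempty ({R' // IsStep R R' ∧ MemS K (fun i => α i + if i = j then 1 else 0) R'} ≃
      ({i // j < i} → K)) := by
  obtain ⟨b, hb⟩ := exists_triangular_basis hR
  refine ⟨(Equiv.ofBijective (fun c => ⟨hyperplane b (extendCoeff c),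
    ⟨hyperplane_le _ _, finrank_quotient_hyperplane b (extendCoeff_self c)⟩,
    memS_hyperplane hR hb (extendCoeff_self c) fun _ => extendCoeff_of_lt c⟩) ⟨?_, ?_⟩).symm⟩
  · intro c c' h
    funext i
    have h' : hyperplane b (extendCoeff c) = hyperplane b (extendCoeff c') := congrArg Subtype.val h
    have h1 := (sub_smul_mem_hyperplane b (extendCoeff_self c) i _).2 rfl
    rw [h', sub_smul_mem_hyperplane b (extendCoeff_self c')] at h1
    simpa [extendCoeff, i.2] using h1
  · rintro ⟨R', hstep, hS⟩
    have hsmul : ∀ w ∈ R', w ∈ coordsLE K j → ∀ a : K, w j = C a * X ^ α j → a = 0 := by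
      intro w hw hwj a hwa
      have hmem : w j ∈ Submodule.span (PowerSeries K) {(X : PowerSeries K) ^ (α j + 1)} := by
        have := hS j
        simp only [if_true] at this
        rw [← this]
        exact ⟨w, ⟨hw, hwj⟩, rfl⟩
      obtain ⟨q, hq⟩ := Submodule.mem_span_singleton.1 hmem
      rw [hwa, smul_eq_mul, pow_succ', ← mul_assoc] at hq
      have h1 := congrArg constantCoeff (mul_right_cancel₀ (pow_ne_zero _ X_ne_zero) hq)
      simpa using h1.symm
    have hbj : (b j : Fin n → PowerSeries K) ∉ R' := fun h =>
      one_ne_zero (hsmul _ h (hb j).1 1 (by simp [(hb j).2]))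
    choose c hc using fun i => hstep.exists_sub_smul_mem (b j).2 hbj (b i).2
    refine ⟨fun i => c i, Subtype.ext (hstep.eq_hyperplane b hbj
      (c := extendCoeff fun i => c i) fun i => ?_)⟩
    rcases lt_trichotomy i j with h | rfl | h
    · have h1 := hsmul _ (hc i) (Submodule.sub_mem _
        (fun k hk => (hb i).1 k (h.trans hk)) (Submodule.smul_mem _ _ (hb j).1)) (-c i)
        (by simp [(hb i).1 j h, (hb j).2])
      have h2 := hc i
      rw [neg_eq_zero.1 h1] at h2
      rwa [extendCoeff_of_lt _ h]
    · simp [extendCoeff_self]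
    · simpa [extendCoeff, h] using hc i

end FlagSteps

/-- Chains of length `d` starting at `x₀` are parametrized by the product of the parameter sets of
their successive steps. -/
theorem nonempty_chain_equiv {T : Type*} {d : ℕ} (A : Fin d → Type*) (P : Fin (d + 1) → T → Prop)
    (Q : Fin d → T → T → Prop)
    (h : ∀ i x, P i.castSucc x → Nonempty ({y // Q i x y ∧ P i.succ y} ≃ A i))
    (x₀ : T) (hx₀ : P 0 x₀) :
    Nonempty ({f : Fin (d + 1) → T //
      f 0 = x₀ ∧ ∀ i : Fin d, Q i (f i.castSucc) (f i.succ) ∧ P i.succ (f i.succ)} ≃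
        ∀ i, A i) := by
  induction d generalizing x₀ with
  | zero =>
    refine ⟨⟨fun _ i => i.elim0, fun _ => ⟨fun _ => x₀, rfl, fun i => i.elim0⟩, ?_, ?_⟩⟩
    · rintro ⟨f, hf, _⟩
      refine Subtype.ext (funext fun i => ?_)
      rw [Fin.fin_one_eq_zero i]
      exact hf.symm
    · intro g
      funext i
      exact i.elim0
  | succ d ih =>
    obtain ⟨e⟩ := h 0 x₀ hx₀
    have ih' := fun y : {y // Q 0 x₀ y ∧ P (Fin.succ 0) y} =>
      ih (fun i => A i.succ) (fun i => P i.succ) (fun i => Q i.succ)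
        (fun i x hx => h i.succ x hx) y.1 y.2.2
    have e' := fun y => (ih' y).some
    let split : {f : Fin (d + 2) → T //
        f 0 = x₀ ∧ ∀ i : Fin (d + 1), Q i (f i.castSucc) (f i.succ) ∧ P i.succ (f i.succ)} ≃
        Σ y : {y // Q 0 x₀ y ∧ P (Fin.succ 0) y}, {f : Fin (d + 1) → T //
          f 0 = y.1 ∧ ∀ i : Fin d, Q i.succ (f i.castSucc) (f i.succ) ∧
            P i.succ.succ (f i.succ)} :=
      { toFun := fun f => ⟨⟨f.1 (Fin.succ 0), by
            have := f.2.2 0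
            rwa [Fin.castSucc_zero, f.2.1] at this⟩,
          ⟨Fin.tail f.1, rfl, fun i => f.2.2 i.succ⟩⟩
        invFun := fun p => ⟨Fin.cons x₀ p.2.1, rfl, fun i => by
          refine Fin.cases ?_ (fun i => ?_) i
          · have := p.1.2
            rw [← p.2.2.1] at this
            exact this
          · exact p.2.2.2 i⟩
        left_inv := by
          rintro ⟨f, rfl, hf⟩
          exact Subtype.ext (Fin.cons_self_tail f)
        right_inv := by
          rintro ⟨⟨y, hy⟩, ⟨f, hf, hf'⟩⟩
          dsimp only at hf
          subst hf
          rfl }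
    exact ⟨split.trans ((Equiv.sigmaCongrRight e').trans ((Equiv.sigmaEquivProd _ _).trans
      ((e.prodCongr (Equiv.refl _)).trans (Fin.consEquiv A))))⟩

theorem card_filter_lt_succ {n d : ℕ} (τ : Fin d → Fin n) (i : Fin d) (j : Fin n) :
    (Finset.univ.filter fun k : Fin d => τ k = j ∧ (k : ℕ) < (i.succ : Fin (d + 1))).card =
      (Finset.univ.filter fun k : Fin d => τ k = j ∧ (k : ℕ) < (i.castSucc : Fin (d + 1))).card +
        if j = τ i then 1 else 0 := by
  simp only [Fin.val_succ, Fin.val_castSucc]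
  split_ifs with h
  · subst h
    rw [← Finset.card_insert_of_notMem (a := i) (by simp)]
    congr 1
    ext k
    simp only [Finset.mem_filter, Finset.mem_univ, true_and, Finset.mem_insert, Fin.ext_iff]
    constructor
    · omega
    · rintro (hk | hk)
      · rw [Fin.ext hk]; simp
      · omega
  · rw [add_zero]
    congr 1
    ext k
    simp only [Finset.mem_filter, Finset.mem_univ, true_and]
    refine and_congr_right fun hk => ⟨fun hlt => ?_, fun hlt => by omega⟩
    have : k ≠ i := by rintro rfl; exact h hk.symm
    have := Fin.val_ne_of_ne this
    omega

/-- For `τ : {1,…,d} → {1,…,n}` with `|τ⁻¹(j)| = λ_j`, setting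
`α^i_j = |τ⁻¹(j) ∩ {1,…,i}|`, the set of flags of lattices `O^n = R_0 ⊃ ⋯ ⊃ R_d` with
`dim_K(R_{i−1}/R_i) = 1` and `R_i ∈ S_{α^i}` is in bijection with `K^N`, where
`N = Σ_{i=1}^d (n − τ(i)) = Σ_{j=1}^n λ_j(n − j)`. -/
theorem stmt14 {n d : ℕ} (lam : Fin n → ℕ) (hlam : Antitone lam) (hd : ∑ j, lam j = d)
    (τ : Fin d → Fin n) (hτ : ∀ j, (Finset.univ.filter fun k => τ k = j).card = lam j) :
    Nonempty
      ({R : Fin (d + 1) → Submodule (PowerSeries K) (Fin n → PowerSeries K) //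
          IsFlag K R ∧
          ∀ i : Fin (d + 1), IsLattice K (R i) ∧
            MemS K
              (fun j => (Finset.univ.filter
                fun k : Fin d => τ k = j ∧ (k : ℕ) < (i : ℕ)).card) (R i)} ≃
        (Fin (∑ i : Fin d, (n - 1 - (τ i : ℕ))) → K)) ∧
    ∑ i : Fin d, (n - 1 - (τ i : ℕ)) = ∑ j : Fin n, lam j * (n - 1 - (j : ℕ)) := by
  constructor
  · let P : Fin (d + 1) → Submodule (PowerSeries K) (Fin n → PowerSeries K) → Prop := fun i R =>
      IsLattice K R ∧ MemS K (fun j => (Finset.univ.filter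
        fun k : Fin d => τ k = j ∧ (k : ℕ) < (i : ℕ)).card) R
    have hstep : ∀ (i : Fin d) (R : Submodule (PowerSeries K) (Fin n → PowerSeries K)),
        P i.castSucc R →
        Nonempty ({R' // IsStep R R' ∧ P i.succ R'} ≃ ({k // τ i < k} → K)) := by
      rintro i R ⟨hlat, hS⟩
      obtain ⟨e⟩ := nonempty_step_equiv hS (τ i)
      refine ⟨(Equiv.subtypeEquivRight fun R' => ?_).trans e⟩
      simp only [P, card_filter_lt_succ]
      exact ⟨fun h => ⟨h.1, h.2.2⟩, fun h => ⟨h.1, h.1.isLattice hlat, h.2⟩⟩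
    have hP0 : P 0 ⊤ := by
      refine ⟨?_, fun i => ?_⟩
      · have : Subsingleton ((Fin n → PowerSeries K) ⧸ Submodule.restrictScalars K
            (⊤ : Submodule (PowerSeries K) (Fin n → PowerSeries K))) :=
          Submodule.Quotient.subsingleton_iff.2 rfl
        exact inferInstanceAs (Module.Finite K _)
      · have : Submodule.span (PowerSeries K) {(1 : PowerSeries K)} = ⊤ :=
          Ideal.span_singleton_one
        simp only [Fin.val_zero, not_lt_zero, and_false, Finset.filter_false, Finset.card_empty,
          pow_zero, this, eq_top_iff]
        rintro x -
        refine ⟨Pi.single i x, ⟨trivial, fun k hk => ?_⟩, ?_⟩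
        · simp [hk.ne']
        · simp
    obtain ⟨e⟩ := nonempty_chain_equiv (fun i => {k // τ i < k} → K) P (fun _ => IsStep)
      hstep ⊤ hP0
    have hcard : Fintype.card (Σ i : Fin d, {k // τ i < k}) =
        ∑ i : Fin d, (n - 1 - (τ i : ℕ)) := by
      rw [Fintype.card_sigma]
      refine Finset.sum_congr rfl fun i _ => ?_
      rw [Fintype.card_subtype, ← Fin.card_Ioi]
      congr 1
      ext k
      simp
    refine ⟨(Equiv.subtypeEquivRight fun R => ?_).trans (e.trans
      ((Equiv.piCurry fun (i : Fin d) (_ : {k // τ i < k}) => K).symm.trans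
        (Equiv.arrowCongr (Fintype.equivFinOfCardEq hcard) (Equiv.refl K))))⟩
    constructor
    · rintro ⟨⟨h0, hR⟩, hRP⟩
      exact ⟨h0, fun i => ⟨hR i, hRP i.succ⟩⟩
    · rintro ⟨h0, hR⟩
      refine ⟨⟨h0, fun i => (hR i).1⟩, fun i => ?_⟩
      refine Fin.cases ?_ (fun i => (hR i).2) i
      rw [h0]
      exact hP0
  · rw [← Finset.sum_fiberwise Finset.univ τ]
    refine Finset.sum_congr rfl fun j _ => ?_
    rw [← hτ j, ← smul_eq_mul, ← Finset.sum_const]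
    refine Finset.sum_congr rfl fun i hi => ?_
    rw [(Finset.mem_filter.1 hi).2]

end
end

section
/- Let λ = (λ_1 ≥ ⋯ ≥ λ_n ≥ 0) with λ_1+⋯+λ_n = d, and let (α^i)_{0≤i≤d} be a sequence of tuples in ℕ^n satisfying: α^{i−1}_j ≤ α^i_j for all i, j; α^i_1 + ⋯ + α^i_n = i for all i; α^d = λ; and each α^i is decreasing (α^i_1 ≥ ⋯ ≥ α^i_n). Then for every flag of lattices O^n = R_0 ⊃ R_1 ⊃ ⋯ ⊃ R_d with dim_K(R_{i−1}/R_i) = 1 and R_i belonging to S_{α^i} for every i, the final lattice R_d satisfies R_d = u·ϖ^λO^n for some upper triangular unipotent matrix u ∈ N(O). -/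
open PowerSeries

noncomputable section

variable (K : Type*) [Field K]

variable {K} in
theorem MemS.dvd {n : ℕ} {α : Fin n → ℕ}
    {R : Submodule (PowerSeries K) (Fin n → PowerSeries K)} (h : MemS K α R) {k : Fin n}
    {v : Fin n → PowerSeries K} (hv : v ∈ R) (hk : v ∈ coordsLE K k) : X ^ α k ∣ v k := by
  rw [← Ideal.mem_span_singleton, ← Ideal.submodule_span_eq, ← h k]
  exact ⟨v, ⟨hv, hk⟩, rfl⟩

variable {K} in
theorem MemS.exists_mem {n : ℕ} {α : Fin n → ℕ}
    {R : Submodule (PowerSeries K) (Fin n → PowerSeries K)} (h : MemS K α R) (k : Fin n) :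
    ∃ w ∈ R, w ∈ coordsLE K k ∧ w k = X ^ α k := by
  have hX : (X ^ α k : PowerSeries K) ∈ Submodule.span (PowerSeries K) {X ^ α k} :=
    Submodule.mem_span_singleton_self _
  rw [← h k] at hX
  obtain ⟨w, ⟨hw, hk⟩, hwk⟩ := hX
  exact ⟨w, hw, hk, hwk⟩

/-- Every vector of `R` supported on coordinates `≤ k` is divisible by `ϖ ^ α k`. -/
def CoordsLEDvd {n : ℕ} (α : Fin n → ℕ)
    (R : Submodule (PowerSeries K) (Fin n → PowerSeries K)) : Prop :=
  ∀ k, ∀ v ∈ R, v ∈ coordsLE K k → ∀ l, X ^ α k ∣ v l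

variable {K} in
theorem CoordsLEDvd.of_le {n : ℕ} {α β : Fin n → ℕ}
    {R S : Submodule (PowerSeries K) (Fin n → PowerSeries K)} (hdiv : CoordsLEDvd K α R)
    (hR : MemS K α R) (hS : MemS K β S) (hSR : S ≤ R) (hαβ : ∀ j, α j ≤ β j)
    (hβα : ∀ l k, l < k → β k ≤ α l) : CoordsLEDvd K β S := by
  intro k v hv hk l
  obtain ⟨w, hw, hwk, hwX⟩ := hR.exists_mem k
  obtain ⟨c, hc⟩ := hS.dvd hv hk
  have hrest : ∀ l, X ^ β k ∣ (v - (X ^ (β k - α k) * c) • w) l := by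
    have hmem : v - (X ^ (β k - α k) * c) • w ∈ R := sub_mem (hSR hv) (R.smul_mem _ hw)
    have hcoord : v - (X ^ (β k - α k) * c) • w ∈ coordsLE K k :=
      sub_mem hk (Submodule.smul_mem _ _ hwk)
    have hzero : (v - (X ^ (β k - α k) * c) • w) k = 0 := by
      have : (X : PowerSeries K) ^ β k = X ^ (β k - α k) * X ^ α k := by
        rw [← pow_add, Nat.sub_add_cancel (hαβ k)]
      simp only [Pi.sub_apply, Pi.smul_apply, smul_eq_mul, hc, hwX, this]
      ring
    intro l
    by_cases hk0 : (k : ℕ) = 0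
    · have : (v - (X ^ (β k - α k) * c) • w) l = 0 := by
        by_cases hl : l = k
        · rw [hl, hzero]
        · exact hcoord l (by omega)
      rw [this]
      exact dvd_zero _
    · let m : Fin n := ⟨k - 1, by omega⟩
      have hmk : m < k := Fin.lt_def.2 (by simp only [m]; omega)
      have hcoord' : v - (X ^ (β k - α k) * c) • w ∈ coordsLE K m := by
        intro j hj
        by_cases hjk : j = k
        · rw [hjk, hzero]
        · refine hcoord j ?_
          have := Fin.lt_def.1 hj
          simp only [m] at this
          omega
      exact (pow_dvd_pow _ (hβα m k hmk)).trans (hdiv m _ hmem hcoord' l)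
  have hmul : X ^ β k ∣ ((X ^ (β k - α k) * c) • w) l := by
    obtain ⟨b, hb⟩ := hdiv k w hw hwk l
    refine ⟨c * b, ?_⟩
    have : (X : PowerSeries K) ^ β k = X ^ (β k - α k) * X ^ α k := by
      rw [← pow_add, Nat.sub_add_cancel (hαβ k)]
    simp only [Pi.smul_apply, smul_eq_mul, hb, this]
    ring
  simpa using dvd_add (hrest l) hmul

variable {K} in
theorem CoordsLEDvd.exists_unipUpper {n : ℕ} {α : Fin n → ℕ}
    {R : Submodule (PowerSeries K) (Fin n → PowerSeries K)} (hdiv : CoordsLEDvd K α R)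
    (hR : MemS K α R) :
    ∃ u : Matrix (Fin n) (Fin n) (PowerSeries K), UnipUpper u ∧
      R = LinearMap.range (Matrix.mulVecLin (u * Matrix.diagonal fun i => X ^ α i)) := by
  choose w hw hwk hwX using hR.exists_mem
  choose y hy using fun k l => hdiv k (w k) (hw k) (hwk k) l
  have hX (k : Fin n) : (X ^ α k : PowerSeries K) ≠ 0 := pow_ne_zero _ X_ne_zero
  refine ⟨Matrix.of fun l k => y k l, ⟨fun k => ?_, fun l k hkl => ?_⟩, ?_⟩
  · exact mul_left_cancel₀ (hX k) (by simp [← hy, hwX])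
  · exact mul_left_cancel₀ (hX k) (by simp [← hy, hwk k l hkl])
  have hcol : (Matrix.of (fun l k => y k l) * Matrix.diagonal fun i => X ^ α i).col = w := by
    ext1 k
    ext1 l
    simp [Matrix.col_apply, Matrix.mul_diagonal, hy k l, mul_comm]
  rw [Matrix.range_mulVecLin, hcol]
  refine le_antisymm ?_ (Submodule.span_le.2 (Set.range_subset_iff.2 hw))
  suffices H : ∀ m : ℕ, ∀ v ∈ R, (∀ j : Fin n, m ≤ j → v j = 0) →
      v ∈ Submodule.span (PowerSeries K) (Set.range w) from
    fun v hv => H n v hv fun j hj => absurd j.2 (by omega)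
  intro m
  induction m with
  | zero =>
    intro v _ hv0
    rw [show v = 0 from funext fun j => hv0 j (Nat.zero_le _)]
    exact zero_mem _
  | succ m ih =>
    intro v hv hv0
    by_cases hm : m < n
    · let k : Fin n := ⟨m, hm⟩
      have hvk : v ∈ coordsLE K k := fun j hj => hv0 j hj
      obtain ⟨c, hc⟩ := hR.dvd hv hvk
      have hrest : v - c • w k ∈ Submodule.span (PowerSeries K) (Set.range w) := by
        refine ih _ (sub_mem hv (R.smul_mem _ (hw k))) fun j hj => ?_
        obtain hj | hj := hj.eq_or_lt
        · obtain rfl : k = j := Fin.ext hj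
          simp [hc, hwX, mul_comm]
        · simp [hvk j hj, hwk k j hj]
      simpa using add_mem hrest
        (Submodule.smul_mem _ c (Submodule.subset_span (Set.mem_range_self k)))
    · exact ih v hv fun j hj => absurd j.2 (by omega)

theorem le_of_sum_eq_sum_add_one {n : ℕ} {α β : Fin n → ℕ} (hαβ : ∀ j, α j ≤ β j)
    (hsum : ∑ j, β j = ∑ j, α j + 1) (hα : Antitone α) (hβ : Antitone β) {l k : Fin n}
    (hlk : l < k) : β k ≤ α l := by
  have hdiff : ∑ j, (β j - α j) = 1 := by
    rw [Finset.sum_tsub_distrib _ fun j _ => hαβ j]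
    omega
  have hpair : ∑ j ∈ {l, k}, (β j - α j) ≤ ∑ j, (β j - α j) :=
    Finset.sum_le_sum_of_subset (Finset.subset_univ _)
  rw [Finset.sum_pair hlk.ne, hdiff] at hpair
  have h1 := hα hlk.le
  have h2 := hβ hlk.le
  omega

/-- If all the `α^i` are decreasing, the last lattice of any flag of type
`(α^i)_i` is of the form `u·ϖ^λ·O^n` with `u ∈ N(O)`. -/
theorem stmt15 {n d : ℕ} (lam : Fin n → ℕ) (hlam : Antitone lam) (hd : ∑ j, lam j = d)
    (α : Fin (d + 1) → Fin n → ℕ)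
    (h1 : ∀ i : Fin d, ∀ j, α i.castSucc j ≤ α i.succ j)
    (h2 : ∀ i : Fin (d + 1), ∑ j, α i j = (i : ℕ))
    (h3 : α (Fin.last d) = lam)
    (h4 : ∀ i, Antitone (α i))
    (R : Fin (d + 1) → Submodule (PowerSeries K) (Fin n → PowerSeries K))
    (hflag : IsFlag K R)
    (hlat : ∀ i, IsLattice K (R i))
    (hmem : ∀ i, MemS K (α i) (R i)) :
    ∃ u : Matrix (Fin n) (Fin n) (PowerSeries K), UnipUpper u ∧
      R (Fin.last d) =
        LinearMap.range
          (Matrix.mulVecLin (u * Matrix.diagonal fun i => X ^ lam i)) := by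
  have hdiv : ∀ i, CoordsLEDvd K (α i) (R i) := by
    intro i
    induction i using Fin.induction with
    | zero =>
      intro k v _ _ l
      have hk : α 0 k = 0 := by
        have := Finset.single_le_sum (fun j _ => Nat.zero_le (α 0 j)) (Finset.mem_univ k)
        rw [h2 0] at this
        simpa using this
      simp [hk]
    | succ i ih =>
      refine ih.of_le (hmem _) (hmem _) (hflag.2 i).1 (h1 i) fun l k hlk => ?_
      exact le_of_sum_eq_sum_add_one (h1 i) (by simp [h2]) (h4 _) (h4 _) hlk
  subst h3
  exact (hdiv _).exists_unipUpper (hmem _)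

end
end
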